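/- arXiv:2308.07740 — 2 statements merged into one kernel-verified Lean document; each statement's English description precedes it below -/
import Mathlib

section
/- Let d ≥ 1 and let k ≥ 2 be an integer. There exists a constant c > 0, depending only on d and k, such that for every M > 0, every T with 0 < T ≤ c·min(M^{−(k−1)/2}, 1), and every u⃗₀ = (u₀,u₁) ∈ F⃗L¹(ℝ^d) with ‖u⃗₀‖_{F⃗L¹} ≤ M: (1) there exists a unique Duhamel solution u ∈ C([0,T]; FL^{0,1}(ℝ^d)) of vNLW with initial data u⃗₀; and (2) this solution satisfies u = Σ_{j=0}^∞ Ξ_j(u⃗₀), the series converging in C([0,T]; FL^{0,1}(ℝ^d)). -/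
open MeasureTheory Real Set Filter Topology
open scoped ENNReal NNReal BigOperators

noncomputable section

/-- Frequency space `ℝ^d` with the Euclidean norm. -/
abbrev Edim (d : ℕ) := EuclideanSpace ℝ (Fin d)

/-! We work entirely on the Fourier side: a function `f` on `ℝ^d` is represented by
its Fourier transform `F = f̂ : ℝ^d → ℂ`. -/

/-- Squared `H^s` norm, computed on the Fourier side:
`‖f‖_{H^s}² = ∫ ⟨ξ⟩^{2s} |f̂(ξ)|² dξ`. -/
def HsNormSq (d : ℕ) (s : ℝ) (F : Edim d → ℂ) : ℝ≥0∞ :=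
  ∫⁻ ξ, ENNReal.ofReal ((1 + ‖ξ‖ ^ 2) ^ s * ‖F ξ‖ ^ 2)

/-- `H^s` norm on the Fourier side. -/
def HsNorm (d : ℕ) (s : ℝ) (F : Edim d → ℂ) : ℝ≥0∞ :=
  HsNormSq d s F ^ (1 / 2 : ℝ)

/-- Norm of `𝓗^s = H^s × H^{s-1}` on the Fourier side. -/
def pairHsNorm (d : ℕ) (s : ℝ) (F G : Edim d → ℂ) : ℝ≥0∞ :=
  (HsNormSq d s F + HsNormSq d (s - 1) G) ^ (1 / 2 : ℝ)

/-- Membership in `H^s`, on the Fourier side. -/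
def MemHs (d : ℕ) (s : ℝ) (F : Edim d → ℂ) : Prop :=
  Measurable F ∧ HsNormSq d s F < ⊤

/-- Membership in `𝓗^s = H^s × H^{s-1}`, on the Fourier side. -/
def MemHsPair (d : ℕ) (s : ℝ) (F G : Edim d → ℂ) : Prop :=
  MemHs d s F ∧ MemHs d (s - 1) G

/-- The Wiener-algebra norm `‖f‖_{FL^{0,1}} = ‖f̂‖_{L¹}`, on the Fourier side. -/
def FLNorm (d : ℕ) (F : Edim d → ℂ) : ℝ≥0∞ :=
  ∫⁻ ξ, (‖F ξ‖₊ : ℝ≥0∞)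

/-- The norm `‖g‖_{FL^{-1,1}} = ‖⟨ξ⟩⁻¹ ĝ‖_{L¹}`, on the Fourier side. -/
def FLm1Norm (d : ℕ) (F : Edim d → ℂ) : ℝ≥0∞ :=
  ∫⁻ ξ, ENNReal.ofReal ((1 + ‖ξ‖ ^ 2) ^ (-(1 : ℝ) / 2) * ‖F ξ‖)

/-- Norm of `F⃗L¹ = FL^{0,1} × FL^{-1,1}`. -/
def pairFLNorm (d : ℕ) (F G : Edim d → ℂ) : ℝ≥0∞ :=
  FLNorm d F + FLm1Norm d G

/-- Membership in `F⃗L¹ = FL^{0,1} × FL^{-1,1}`, on the Fourier side. -/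
def MemFLPair (d : ℕ) (F G : Edim d → ℂ) : Prop :=
  Measurable F ∧ Measurable G ∧ pairFLNorm d F G < ⊤

/-- Symbol of `V₀(t)`: `cos((√3/2)|ξ|t) + (1/√3) sin((√3/2)|ξ|t)`. -/
def V0sym (t r : ℝ) : ℝ :=
  Real.cos (Real.sqrt 3 / 2 * r * t) + 1 / Real.sqrt 3 * Real.sin (Real.sqrt 3 / 2 * r * t)

/-- Symbol of `V₁(t)`: `sin((√3/2)|ξ|t) / ((√3/2)|ξ|)`. -/
def V1sym (t r : ℝ) : ℝ :=
  Real.sin (Real.sqrt 3 / 2 * r * t) / (Real.sqrt 3 / 2 * r)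

/-- Symbol of the Poisson kernel `P(t)`: `e^{-|ξ|t/2}`. -/
def Psym (t r : ℝ) : ℝ := Real.exp (-(r * t) / 2)

/-- Symbol of `W(t) = P(t)V₁(t)`. -/
def Wsym (t r : ℝ) : ℝ := Psym t r * V1sym t r

/-- Fourier side of the linear flow `V(t)(u₀,u₁) = P(t)(V₀(t)u₀ + V₁(t)u₁)`. -/
def Vflow (d : ℕ) (F₀ F₁ : Edim d → ℂ) (t : ℝ) (ξ : Edim d) : ℂ :=
  ((Psym t ‖ξ‖ * V0sym t ‖ξ‖ : ℝ) : ℂ) * F₀ ξ + ((Psym t ‖ξ‖ * V1sym t ‖ξ‖ : ℝ) : ℂ) * F₁ ξ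

/-- Convolution on `ℝ^d`. -/
def conv (d : ℕ) (f g : Edim d → ℂ) (ξ : Edim d) : ℂ :=
  ∫ η, f (ξ - η) * g η

/-- `convIter d f n` is the `(n+1)`-fold convolution `f ∗ ⋯ ∗ f`. -/
def convIter (d : ℕ) (f : Edim d → ℂ) : ℕ → Edim d → ℂ
  | 0 => f
  | n + 1 => conv d (convIter d f n) f

/-- Convolution of a (nonempty) list of functions. -/
def listConv (d : ℕ) : List (Edim d → ℂ) → Edim d → ℂ
  | [] => fun _ => 0
  | f :: fs => fs.foldl (conv d) f

/-- Fourier side of the Duhamel operator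
`I_k(u₁,…,u_k)(t) = -∫₀ᵗ W(t-t') ∏ u_j(t') dt'`. -/
def Ik (d k : ℕ) (us : Fin k → ℝ → Edim d → ℂ) (t : ℝ) (ξ : Edim d) : ℂ :=
  -(∫ t' in (0 : ℝ)..t,
      ((Wsym (t - t') ‖ξ‖ : ℝ) : ℂ) * listConv d (List.ofFn fun i => us i t') ξ)

/-- Picard iterates `Ξ_j` of vNLW, on the Fourier side:
`Ξ₀(u⃗₀)(t) = V(t)u⃗₀` and
`Ξ_j(u⃗₀) = ∑_{j₁+⋯+j_k = j-1} I_k(Ξ_{j₁}(u⃗₀),…,Ξ_{j_k}(u⃗₀))`. -/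
def Xi (d k : ℕ) (F₀ F₁ : Edim d → ℂ) : ℕ → ℝ → Edim d → ℂ
  | 0 => Vflow d F₀ F₁
  | j + 1 => fun t ξ =>
      ∑ l ∈ (Finset.Nat.antidiagonalTuple k j).attach,
        Ik d k (fun i => Xi d k F₀ F₁ (l.1 i)) t ξ
  decreasing_by
    have h := Finset.Nat.mem_antidiagonalTuple.mp l.2
    have hle := Finset.single_le_sum (f := l.1) (fun j _ => Nat.zero_le (l.1 j))
      (Finset.mem_univ i)
    omega

/-- `u : [0,T] → FL^{0,1}(ℝ^d)` (represented on the Fourier side) is a Duhamel solution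
of vNLW with nonlinearity `-u^k` and initial data `(u₀,u₁)` with `û₀ = F₀`, `û₁ = F₁`. -/
structure IsDuhamelSolution (d k : ℕ) (T : ℝ) (F₀ F₁ : Edim d → ℂ)
    (u : ℝ → Edim d → ℂ) : Prop where
  measurable : ∀ t ∈ Set.Icc (0 : ℝ) T, Measurable (u t)
  finite : ∀ t ∈ Set.Icc (0 : ℝ) T, FLNorm d (u t) < ⊤
  continuous : ∀ t₀ ∈ Set.Icc (0 : ℝ) T, ∀ ε : ℝ, 0 < ε → ∃ δ : ℝ, 0 < δ ∧
    ∀ t ∈ Set.Icc (0 : ℝ) T, |t - t₀| < δ →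
      FLNorm d (fun ξ => u t ξ - u t₀ ξ) < ENNReal.ofReal ε
  duhamel : ∀ t ∈ Set.Icc (0 : ℝ) T, ∀ᵐ ξ : Edim d, u t ξ =
    ((Psym t ‖ξ‖ * V0sym t ‖ξ‖ : ℝ) : ℂ) * F₀ ξ
      + ((Psym t ‖ξ‖ * V1sym t ‖ξ‖ : ℝ) : ℂ) * F₁ ξ
      - ∫ t' in (0 : ℝ)..t,
          ((Wsym (t - t') ‖ξ‖ : ℝ) : ℂ) * convIter d (u t') (k - 1) ξ

/-- The cube `Q_A = [-A/8, A/8]^d`. -/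
def cubeSet (d : ℕ) (A : ℝ) : Set (Edim d) := {ξ | ∀ i, |ξ i| ≤ A / 8}

/-- `Ω = ⋃_{η ∈ Σ} (η + Q_A)` with `Σ = {-2Ne₁, -Ne₁, Ne₁, 2Ne₁}`. -/
def OmegaSet (d : ℕ) (N A : ℝ) : Set (Edim d) :=
  {ξ | ∃ c : ℝ, (c = -2 * N ∨ c = -N ∨ c = N ∨ c = 2 * N) ∧
    ∀ i : Fin d, |ξ i - (if (i : ℕ) = 0 then c else 0)| ≤ A / 8}

/-- `Ω_k = ⋃_{η ∈ Σ_k} (η + Q_A)` with `Σ_k = {-Ne₁, Ne₁}` for even `k` and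
`Σ_k = {-2Ne₁, -Ne₁, Ne₁, 2Ne₁}` for odd `k`. -/
def OmegaKSet (d k : ℕ) (N A : ℝ) : Set (Edim d) :=
  {ξ | ∃ c : ℝ, (if k % 2 = 0 then c = -N ∨ c = N
      else c = -2 * N ∨ c = -N ∨ c = N ∨ c = 2 * N) ∧
    ∀ i : Fin d, |ξ i - (if (i : ℕ) = 0 then c else 0)| ≤ A / 8}

/-- `φ̂ = R·𝟙_Ω`. -/
def phiHat (d : ℕ) (N A R : ℝ) : Edim d → ℂ :=
  Set.indicator (OmegaSet d N A) fun _ => (R : ℂ)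

/-- `φ̂ = R·𝟙_{Ω_k}`. -/
def phiHatK (d k : ℕ) (N A R : ℝ) : Edim d → ℂ :=
  Set.indicator (OmegaKSet d k N A) fun _ => (R : ℂ)

/-- `g_s(A)`: `1` if `s < -d/2`; `(log⟨A⟩)^{1/2}` if `s = -d/2`; `A^{d/2+s}` if `s > -d/2`. -/
def gs (d : ℕ) (s A : ℝ) : ℝ :=
  if s < -(d : ℝ) / 2 then 1
  else if s = -(d : ℝ) / 2 then Real.sqrt (Real.log (Real.sqrt (1 + A ^ 2)))
  else A ^ ((d : ℝ) / 2 + s)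

/-! ### The `L¹` norm and convolution -/

lemma FLNorm_eq_lintegral_enorm (d : ℕ) (F : Edim d → ℂ) : FLNorm d F = ∫⁻ ξ, ‖F ξ‖ₑ := rfl

lemma integrable_of_FLNorm_lt_top {d : ℕ} {F : Edim d → ℂ} (hF : Measurable F)
    (h : FLNorm d F < ⊤) : Integrable F :=
  ⟨hF.aestronglyMeasurable, h⟩

lemma FLNorm_congr_ae {d : ℕ} {F G : Edim d → ℂ} (h : F =ᵐ[volume] G) :
    FLNorm d F = FLNorm d G := by
  simp only [FLNorm_eq_lintegral_enorm]
  exact lintegral_congr_ae (h.mono fun ξ hξ => by simp only [hξ])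

lemma FLNorm_add_le {d : ℕ} {F G : Edim d → ℂ} (hF : Measurable F) :
    FLNorm d (fun ξ => F ξ + G ξ) ≤ FLNorm d F + FLNorm d G := by
  simp only [FLNorm_eq_lintegral_enorm]
  rw [← lintegral_add_left hF.enorm]
  exact lintegral_mono fun ξ => enorm_add_le _ _

lemma FLNorm_sub_comm {d : ℕ} (F G : Edim d → ℂ) :
    FLNorm d (fun ξ => F ξ - G ξ) = FLNorm d (fun ξ => G ξ - F ξ) := by
  simp only [FLNorm_eq_lintegral_enorm]
  exact lintegral_congr fun ξ => by rw [← neg_sub, enorm_neg]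

lemma FLNorm_sub_le {d : ℕ} {F G H : Edim d → ℂ} (hF : Measurable F) (hG : Measurable G) :
    FLNorm d (fun ξ => F ξ - H ξ)
      ≤ FLNorm d (fun ξ => F ξ - G ξ) + FLNorm d (fun ξ => G ξ - H ξ) := by
  refine le_trans (le_of_eq ?_) (FLNorm_add_le (hF.sub hG))
  congr 1
  ext ξ
  ring

lemma FLNorm_sum_le {d : ℕ} {ι : Type*} (s : Finset ι) {F : ι → Edim d → ℂ}
    (hF : ∀ i ∈ s, Measurable (F i)) :
    FLNorm d (fun ξ => ∑ i ∈ s, F i ξ) ≤ ∑ i ∈ s, FLNorm d (F i) := by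
  simp only [FLNorm_eq_lintegral_enorm]
  rw [← lintegral_finsetSum' _ fun i hi => (hF i hi).enorm.aemeasurable]
  exact lintegral_mono fun ξ => enorm_sum_le _ _

lemma measurable_conv_uncurry {α : Type*} [MeasurableSpace α] {d : ℕ} {f g : α → Edim d → ℂ}
    (hf : Measurable (Function.uncurry f)) (hg : Measurable (Function.uncurry g)) :
    Measurable (Function.uncurry fun a => conv d (f a) (g a)) := by
  have h : StronglyMeasurable (Function.uncurry
      fun (p : α × Edim d) (η : Edim d) => f p.1 (p.2 - η) * g p.1 η) := by
    apply Measurable.stronglyMeasurable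
    refine Measurable.mul ?_ ?_
    · exact hf.comp ((measurable_fst.comp measurable_fst).prodMk
        ((measurable_snd.comp measurable_fst).sub measurable_snd))
    · exact hg.comp ((measurable_fst.comp measurable_fst).prodMk measurable_snd)
  exact h.integral_prod_right.measurable

lemma measurable_conv {d : ℕ} {f g : Edim d → ℂ} (hf : Measurable f) (hg : Measurable g) :
    Measurable (conv d f g) := by
  have := measurable_conv_uncurry (α := Unit) (f := fun _ => f) (g := fun _ => g)
    (hf.comp measurable_snd) (hg.comp measurable_snd)
  exact this.comp (measurable_const.prodMk measurable_id : Measurable fun ξ => ((), ξ))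

lemma FLNorm_conv_le {d : ℕ} {f g : Edim d → ℂ} (hf : Measurable f) (hg : Measurable g) :
    FLNorm d (conv d f g) ≤ FLNorm d f * FLNorm d g := by
  simp only [FLNorm_eq_lintegral_enorm]
  calc ∫⁻ ξ, ‖conv d f g ξ‖ₑ ≤ ∫⁻ ξ, ∫⁻ η, ‖f (ξ - η)‖ₑ * ‖g η‖ₑ := by
        refine lintegral_mono fun ξ => (enorm_integral_le_lintegral_enorm _).trans ?_
        simp only [enorm_mul, le_refl]
    _ = ∫⁻ η, ∫⁻ ξ, ‖f (ξ - η)‖ₑ * ‖g η‖ₑ := by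
        refine lintegral_lintegral_swap (Measurable.aemeasurable ?_)
        exact (hf.comp (measurable_fst.sub measurable_snd)).enorm.mul
          (hg.comp measurable_snd).enorm
    _ = ∫⁻ η, (∫⁻ ξ, ‖f ξ‖ₑ) * ‖g η‖ₑ := by
        refine lintegral_congr fun η => ?_
        have h : Measurable fun ξ => ‖f (ξ - η)‖ₑ :=
          (hf.comp (measurable_id.sub_const η)).enorm
        rw [lintegral_mul_const'' _ h.aemeasurable,
          lintegral_sub_right_eq_self (fun ξ => ‖f ξ‖ₑ) η]
    _ = _ := by rw [lintegral_const_mul'' _ hg.enorm.aemeasurable]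

lemma conv_congr_ae {d : ℕ} {f f' g g' : Edim d → ℂ} (hf : f =ᵐ[volume] f')
    (hg : g =ᵐ[volume] g') : conv d f g = conv d f' g' := by
  ext ξ
  refine integral_congr_ae ?_
  have h : (fun η => f (ξ - η)) =ᵐ[volume] fun η => f' (ξ - η) :=
    (quasiMeasurePreserving_sub_left volume ξ).ae_eq_comp hf
  filter_upwards [h, hg] with η h₁ h₂
  rw [h₁, h₂]

lemma conv_eq_convolution {d : ℕ} (f g : Edim d → ℂ) :
    conv d f g = convolution g f (ContinuousLinearMap.mul ℂ ℂ) volume := by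
  ext ξ
  simp only [conv, convolution, ContinuousLinearMap.mul_apply', mul_comm]

lemma integrable_conv {d : ℕ} {f g : Edim d → ℂ} (hf : Integrable f) (hg : Integrable g) :
    Integrable (conv d f g) := by
  rw [conv_eq_convolution]
  exact hg.integrable_convolution _ hf

lemma ae_integrable_conv_integrand {d : ℕ} {f g : Edim d → ℂ} (hf : Integrable f)
    (hg : Integrable g) : ∀ᵐ ξ : Edim d, Integrable fun η => f (ξ - η) * g η := by
  filter_upwards [hg.ae_convolution_exists (ContinuousLinearMap.mul ℂ ℂ) hf] with ξ h
  simpa only [ConvolutionExistsAt, ContinuousLinearMap.mul_apply', mul_comm] using h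

lemma conv_add_left_ae {d : ℕ} {f f' g : Edim d → ℂ} (hf : Integrable f) (hf' : Integrable f')
    (hg : Integrable g) :
    conv d (f + f') g =ᵐ[volume] conv d f g + conv d f' g := by
  filter_upwards [ae_integrable_conv_integrand hf hg, ae_integrable_conv_integrand hf' hg]
    with ξ h h'
  simp only [conv, Pi.add_apply, add_mul]
  exact integral_add h h'

lemma conv_add_right_ae {d : ℕ} {f g g' : Edim d → ℂ} (hf : Integrable f) (hg : Integrable g)
    (hg' : Integrable g') :
    conv d f (g + g') =ᵐ[volume] conv d f g + conv d f g' := by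
  filter_upwards [ae_integrable_conv_integrand hf hg, ae_integrable_conv_integrand hf hg']
    with ξ h h'
  simp only [conv, Pi.add_apply, mul_add]
  exact integral_add h h'

lemma conv_smul_left {d : ℕ} (c : ℂ) (f g : Edim d → ℂ) :
    conv d (c • f) g = c • conv d f g := by
  ext ξ
  simp only [conv, Pi.smul_apply, smul_eq_mul, mul_assoc, integral_const_mul]

lemma conv_smul_right {d : ℕ} (c : ℂ) (f g : Edim d → ℂ) :
    conv d f (c • g) = c • conv d f g := by
  ext ξ
  simp only [conv, Pi.smul_apply, smul_eq_mul, mul_left_comm _ c, integral_const_mul]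

/-- The space `L¹(ℝ^d)` of a.e. classes on the frequency side. -/
abbrev FreqL1 (d : ℕ) := Edim d →₁[(volume : Measure (Edim d))] ℂ

/-- Convolution as a bounded bilinear map on `L¹`. -/
def convL1 (d : ℕ) : FreqL1 d →L[ℂ] FreqL1 d →L[ℂ] FreqL1 d :=
  LinearMap.mkContinuous₂
    (LinearMap.mk₂ ℂ
      (fun f g => (integrable_conv (L1.integrable_coeFn f) (L1.integrable_coeFn g)).toL1 _)
      (fun f f' g => by
        rw [← Integrable.toL1_add, Integrable.toL1_eq_toL1_iff]
        rw [conv_congr_ae (Lp.coeFn_add f f') (EventuallyEq.refl _ g)]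
        exact conv_add_left_ae (L1.integrable_coeFn f) (L1.integrable_coeFn f')
          (L1.integrable_coeFn g))
      (fun c f g => by
        rw [← Integrable.toL1_smul, Integrable.toL1_eq_toL1_iff]
        rw [conv_congr_ae (Lp.coeFn_smul c f) (EventuallyEq.refl _ g), conv_smul_left]
        rfl)
      (fun f g g' => by
        rw [← Integrable.toL1_add, Integrable.toL1_eq_toL1_iff]
        rw [conv_congr_ae (EventuallyEq.refl _ f) (Lp.coeFn_add g g')]
        exact conv_add_right_ae (L1.integrable_coeFn f) (L1.integrable_coeFn g)
          (L1.integrable_coeFn g'))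
      (fun c f g => by
        rw [← Integrable.toL1_smul, Integrable.toL1_eq_toL1_iff]
        rw [conv_congr_ae (EventuallyEq.refl _ f) (Lp.coeFn_smul c g), conv_smul_right]
        rfl))
    1 fun f g => by
      have h := FLNorm_conv_le (Lp.stronglyMeasurable f).measurable
        (Lp.stronglyMeasurable g).measurable
      simp only [FLNorm_eq_lintegral_enorm] at h
      rw [← Integrable.enorm_toL1 (integrable_conv (L1.integrable_coeFn f)
        (L1.integrable_coeFn g)), ← L1.ofReal_norm_eq_lintegral, ← L1.ofReal_norm_eq_lintegral,
        ← ofReal_norm, ← ENNReal.ofReal_mul (norm_nonneg _),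
        ENNReal.ofReal_le_ofReal_iff (by positivity)] at h
      simpa using h

lemma convL1_toL1 {d : ℕ} {f g : Edim d → ℂ} (hf : Integrable f) (hg : Integrable g) :
    convL1 d (hf.toL1 f) (hg.toL1 g) = (integrable_conv hf hg).toL1 _ := by
  simp only [convL1, LinearMap.mkContinuous₂_apply, LinearMap.mk₂_apply]
  rw [Integrable.toL1_eq_toL1_iff, conv_congr_ae hf.coeFn_toL1 hg.coeFn_toL1]

lemma norm_convL1_le (d : ℕ) : ‖convL1 d‖ ≤ 1 :=
  LinearMap.mkContinuous₂_norm_le _ zero_le_one _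

/-- The `(m+1)`-fold convolution as a bounded multilinear map on `L¹`. -/
def convMultilinear (d : ℕ) :
    (m : ℕ) → ContinuousMultilinearMap ℂ (fun _ : Fin (m + 1) => FreqL1 d) (FreqL1 d)
  | 0 => ContinuousMultilinearMap.ofSubsingleton ℂ (FreqL1 d) (FreqL1 d) (0 : Fin 1)
      (ContinuousLinearMap.id ℂ (FreqL1 d))
  | m + 1 => ContinuousMultilinearMap.uncurryRight
      ((convL1 d).compContinuousMultilinearMap (convMultilinear d m))

lemma norm_convMultilinear_le (d m : ℕ) : ‖convMultilinear d m‖ ≤ 1 := by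
  induction m with
  | zero => exact ContinuousMultilinearMap.norm_ofSubsingleton_id_le ℂ (FreqL1 d) (0 : Fin 1)
  | succ m ih =>
    rw [convMultilinear, ContinuousMultilinearMap.uncurryRight_norm]
    refine (ContinuousLinearMap.norm_compContinuousMultilinearMap_le _ _).trans ?_
    exact mul_le_one₀ (norm_convL1_le d) (norm_nonneg _) ih

lemma listConv_ofFn_one {d : ℕ} (f : Fin (0 + 1) → Edim d → ℂ) :
    listConv d (List.ofFn f) = f 0 := by
  simp [listConv]

lemma listConv_ofFn_succ {d m : ℕ} (f : Fin (m + 2) → Edim d → ℂ) :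
    listConv d (List.ofFn f)
      = conv d (listConv d (List.ofFn fun i : Fin (m + 1) => f i.castSucc)) (f (Fin.last _)) := by
  rw [List.ofFn_succ', List.ofFn_succ (n := m), List.concat_eq_append, List.cons_append, listConv,
    List.foldl_append, listConv, List.foldl_cons, List.foldl_nil]

lemma convIter_eq_listConv {d : ℕ} (f : Edim d → ℂ) (m : ℕ) :
    convIter d f m = listConv d (List.ofFn fun _ : Fin (m + 1) => f) := by
  induction m with
  | zero => rw [listConv_ofFn_one, convIter]
  | succ m ih => rw [listConv_ofFn_succ, convIter, ih]

lemma measurable_listConv_uncurry {α : Type*} [MeasurableSpace α] {d m : ℕ}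
    {f : Fin (m + 1) → α → Edim d → ℂ} (hf : ∀ i, Measurable (Function.uncurry (f i))) :
    Measurable (Function.uncurry fun a => listConv d (List.ofFn fun i => f i a)) := by
  induction m with
  | zero => simpa only [listConv_ofFn_one] using hf 0
  | succ m ih =>
    simp only [listConv_ofFn_succ]
    exact measurable_conv_uncurry (ih fun i => hf i.castSucc) (hf _)

lemma measurable_listConv {d m : ℕ} {f : Fin (m + 1) → Edim d → ℂ}
    (hf : ∀ i, Measurable (f i)) : Measurable (listConv d (List.ofFn f)) := by
  induction m with
  | zero => simpa only [listConv_ofFn_one] using hf 0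
  | succ m ih =>
    simp only [listConv_ofFn_succ]
    exact measurable_conv (ih fun i => hf i.castSucc) (hf _)

lemma integrable_listConv {d m : ℕ} {f : Fin (m + 1) → Edim d → ℂ}
    (hf : ∀ i, Integrable (f i)) : Integrable (listConv d (List.ofFn f)) := by
  induction m with
  | zero => simpa only [listConv_ofFn_one] using hf 0
  | succ m ih =>
    simp only [listConv_ofFn_succ]
    exact integrable_conv (ih fun i => hf i.castSucc) (hf _)

lemma FLNorm_listConv_le {d m : ℕ} {f : Fin (m + 1) → Edim d → ℂ}
    (hf : ∀ i, Measurable (f i)) :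
    FLNorm d (listConv d (List.ofFn f)) ≤ ∏ i, FLNorm d (f i) := by
  induction m with
  | zero =>
    rw [listConv_ofFn_one]
    simp
  | succ m ih =>
    simp only [listConv_ofFn_succ]
    rw [Fin.prod_univ_castSucc]
    exact (FLNorm_conv_le (measurable_listConv fun i => hf i.castSucc) (hf _)).trans
      (mul_le_mul_left (ih fun i => hf i.castSucc) _)

lemma convMultilinear_toL1 {d m : ℕ} {f : Fin (m + 1) → Edim d → ℂ}
    (hf : ∀ i, Integrable (f i)) :
    convMultilinear d m (fun i => (hf i).toL1 (f i)) = (integrable_listConv hf).toL1 _ := by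
  induction m with
  | zero =>
    simp only [listConv_ofFn_one]
    rfl
  | succ m ih =>
    simp only [convMultilinear, ContinuousMultilinearMap.uncurryRight_apply,
      ContinuousLinearMap.compContinuousMultilinearMap_coe, Function.comp_apply,
      listConv_ofFn_succ]
    rw [← convL1_toL1 (integrable_listConv fun i => hf i.castSucc) (hf _),
      ← ih fun i => hf i.castSucc]
    rfl

lemma convIter_congr_ae {d : ℕ} {f g : Edim d → ℂ} (h : f =ᵐ[volume] g) (m : ℕ) :
    convIter d f (m + 1) = convIter d g (m + 1) := by
  induction m with
  | zero => exact conv_congr_ae h h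
  | succ m ih =>
    rw [convIter, ih]
    exact conv_congr_ae (EventuallyEq.refl _ _) h

/-! ### Bounds on the symbols and the linear flow -/

lemma Psym_nonneg (t r : ℝ) : 0 ≤ Psym t r := (Real.exp_pos _).le

lemma Psym_le_one {t r : ℝ} (ht : 0 ≤ t) (hr : 0 ≤ r) : Psym t r ≤ 1 := by
  rw [Psym, Real.exp_le_one_iff]
  have := mul_nonneg hr ht
  linarith

lemma abs_V0sym_le (t r : ℝ) : |V0sym t r| ≤ 2 := by
  have h3 : 1 / Real.sqrt 3 ≤ 1 := by
    rw [div_le_one (by positivity)]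
    exact Real.one_le_sqrt.2 (by norm_num)
  refine (abs_add_le _ _).trans ?_
  rw [abs_mul, abs_of_nonneg (by positivity : (0 : ℝ) ≤ 1 / Real.sqrt 3)]
  have h₁ := Real.abs_cos_le_one (Real.sqrt 3 / 2 * r * t)
  have h₂ := mul_le_one₀ h3 (abs_nonneg _) (Real.abs_sin_le_one (Real.sqrt 3 / 2 * r * t))
  linarith

lemma abs_V1sym_le {t r : ℝ} (ht : 0 ≤ t) (hr : 0 ≤ r) : |V1sym t r| ≤ t := by
  rw [V1sym, abs_div, abs_of_nonneg (by positivity : 0 ≤ Real.sqrt 3 / 2 * r)]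
  refine div_le_of_le_mul₀ (by positivity) ht ?_
  refine (Real.abs_sin_le_abs).trans (le_of_eq ?_)
  rw [abs_of_nonneg (by positivity), mul_comm]

lemma abs_V1sym_mul_le {t r : ℝ} (hr : 0 ≤ r) : |V1sym t r| * r ≤ 2 := by
  have h3 : 1 ≤ Real.sqrt 3 := Real.one_le_sqrt.2 (by norm_num)
  rcases hr.eq_or_lt with rfl | hr
  · simp
  rw [V1sym, abs_div, abs_of_nonneg (by positivity : 0 ≤ Real.sqrt 3 / 2 * r),
    div_mul_eq_mul_div, div_le_iff₀ (by positivity)]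
  have h₁ := mul_le_mul_of_nonneg_right (Real.abs_sin_le_one (Real.sqrt 3 / 2 * r * t)) hr.le
  nlinarith

lemma abs_Wsym_le {t r : ℝ} (ht : 0 ≤ t) (hr : 0 ≤ r) : |Wsym t r| ≤ t := by
  rw [Wsym, abs_mul, abs_of_nonneg (Psym_nonneg _ _)]
  exact (mul_le_of_le_one_left (abs_nonneg _) (Psym_le_one ht hr)).trans (abs_V1sym_le ht hr)

lemma abs_Psym_mul_V0sym_le {t r : ℝ} (ht : 0 ≤ t) (hr : 0 ≤ r) :
    |Psym t r * V0sym t r| ≤ 2 := by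
  rw [abs_mul, abs_of_nonneg (Psym_nonneg _ _)]
  exact (mul_le_of_le_one_left (abs_nonneg _) (Psym_le_one ht hr)).trans (abs_V0sym_le t r)

lemma abs_Psym_mul_V1sym_le {t r : ℝ} (ht : 0 ≤ t) (ht1 : t ≤ 1) (hr : 0 ≤ r) :
    |Psym t r * V1sym t r| ≤ 3 * (1 + r ^ 2) ^ (-(1 : ℝ) / 2) := by
  have hpos : 0 < Real.sqrt (1 + r ^ 2) := Real.sqrt_pos.2 (by positivity)
  have hs : Real.sqrt (1 + r ^ 2) ≤ 1 + r := by
    rw [Real.sqrt_le_left (by positivity)]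
    nlinarith
  have h : (1 + r ^ 2) ^ (-(1 : ℝ) / 2) = (Real.sqrt (1 + r ^ 2))⁻¹ := by
    rw [Real.sqrt_eq_rpow, ← Real.rpow_neg (by positivity)]
    norm_num
  rw [h, ← div_eq_mul_inv, le_div_iff₀ hpos, abs_mul, abs_of_nonneg (Psym_nonneg _ _)]
  have h₁ := mul_le_of_le_one_left (abs_nonneg (V1sym t r)) (Psym_le_one ht hr)
  have h₂ := (abs_V1sym_le ht hr).trans ht1
  have h₃ := abs_V1sym_mul_le (t := t) hr
  calc Psym t r * |V1sym t r| * Real.sqrt (1 + r ^ 2) ≤ |V1sym t r| * (1 + r) := by gcongr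
    _ ≤ 3 := by linarith

lemma continuous_Psym (r : ℝ) : Continuous fun t => Psym t r := by
  unfold Psym; fun_prop

lemma continuous_V0sym (r : ℝ) : Continuous fun t => V0sym t r := by
  unfold V0sym; fun_prop

lemma continuous_V1sym (r : ℝ) : Continuous fun t => V1sym t r := by
  unfold V1sym; fun_prop

lemma continuous_Wsym (r : ℝ) : Continuous fun t => Wsym t r :=
  (continuous_Psym r).mul (continuous_V1sym r)

lemma measurable_Psym : Measurable (Function.uncurry Psym) := by
  unfold Psym Function.uncurry; fun_prop

lemma measurable_V0sym : Measurable (Function.uncurry V0sym) := by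
  unfold V0sym Function.uncurry; fun_prop

lemma measurable_V1sym : Measurable (Function.uncurry V1sym) := by
  unfold V1sym Function.uncurry; fun_prop

lemma measurable_Wsym : Measurable (Function.uncurry Wsym) :=
  measurable_Psym.mul measurable_V1sym

lemma measurable_Vflow_uncurry {d : ℕ} {F₀ F₁ : Edim d → ℂ} (h₀ : Measurable F₀)
    (h₁ : Measurable F₁) : Measurable (Function.uncurry (Vflow d F₀ F₁)) := by
  have hn : Measurable fun p : ℝ × Edim d => (p.1, ‖p.2‖) :=
    measurable_fst.prodMk measurable_snd.norm
  have hP := measurable_Psym.comp hn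
  have hV0 := measurable_V0sym.comp hn
  have hV1 := measurable_V1sym.comp hn
  exact ((Complex.measurable_ofReal.comp (hP.mul hV0)).mul (h₀.comp measurable_snd)).add
    ((Complex.measurable_ofReal.comp (hP.mul hV1)).mul (h₁.comp measurable_snd))

lemma enorm_Vflow_le {d : ℕ} (F₀ F₁ : Edim d → ℂ) {t : ℝ} (ht : 0 ≤ t) (ht1 : t ≤ 1)
    (ξ : Edim d) :
    ‖Vflow d F₀ F₁ t ξ‖ₑ ≤ 3 * (‖F₀ ξ‖ₑ
      + ENNReal.ofReal ((1 + ‖ξ‖ ^ 2) ^ (-(1 : ℝ) / 2) * ‖F₁ ξ‖)) := by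
  rw [← ofReal_norm, ← ofReal_norm, ← ENNReal.ofReal_add (by positivity) (by positivity),
    ← ENNReal.ofReal_ofNat, ← ENNReal.ofReal_mul (by norm_num)]
  refine ENNReal.ofReal_le_ofReal ?_
  refine (norm_add_le _ _).trans ?_
  rw [norm_mul, norm_mul, Complex.norm_real, Complex.norm_real, Real.norm_eq_abs,
    Real.norm_eq_abs]
  have h₀ := mul_le_mul_of_nonneg_right (abs_Psym_mul_V0sym_le ht (norm_nonneg ξ))
    (norm_nonneg (F₀ ξ))
  have h₁ := mul_le_mul_of_nonneg_right (abs_Psym_mul_V1sym_le ht ht1 (norm_nonneg ξ))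
    (norm_nonneg (F₁ ξ))
  have := norm_nonneg (F₀ ξ)
  nlinarith

lemma lintegral_Vflow_bound {d : ℕ} {F₀ : Edim d → ℂ} (h₀ : Measurable F₀) (F₁ : Edim d → ℂ) :
    ∫⁻ ξ, 3 * (‖F₀ ξ‖ₑ + ENNReal.ofReal ((1 + ‖ξ‖ ^ 2) ^ (-(1 : ℝ) / 2) * ‖F₁ ξ‖))
      = 3 * pairFLNorm d F₀ F₁ := by
  rw [lintegral_const_mul' _ _ (by norm_num), lintegral_add_left h₀.enorm]
  rfl

lemma FLNorm_Vflow_le {d : ℕ} {F₀ F₁ : Edim d → ℂ} (h₀ : Measurable F₀) {t : ℝ}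
    (ht : 0 ≤ t) (ht1 : t ≤ 1) :
    FLNorm d (Vflow d F₀ F₁ t) ≤ 3 * pairFLNorm d F₀ F₁ := by
  rw [← lintegral_Vflow_bound h₀]
  exact lintegral_mono fun ξ => enorm_Vflow_le F₀ F₁ ht ht1 ξ

lemma continuous_Vflow {d : ℕ} (F₀ F₁ : Edim d → ℂ) (ξ : Edim d) :
    Continuous fun t => Vflow d F₀ F₁ t ξ := by
  have hP := continuous_Psym ‖ξ‖
  exact ((Complex.continuous_ofReal.comp (hP.mul (continuous_V0sym ‖ξ‖))).mul
    continuous_const).add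
    ((Complex.continuous_ofReal.comp (hP.mul (continuous_V1sym ‖ξ‖))).mul continuous_const)

lemma tendsto_FLNorm_sub_of_dominated {d : ℕ} {f : ℝ → Edim d → ℂ} {S : Set ℝ} {s : ℝ}
    (hs : s ∈ S) (hm : ∀ t, Measurable (f t)) (B : Edim d → ℝ≥0∞) (hB : ∫⁻ ξ, B ξ ≠ ⊤)
    (hf : ∀ t ∈ S, ∀ ξ, ‖f t ξ‖ₑ ≤ B ξ) (hc : ∀ ξ, Continuous fun t => f t ξ) :
    Tendsto (fun t => FLNorm d (fun ξ => f t ξ - f s ξ)) (𝓝[S] s) (𝓝 0) := by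
  have key := tendsto_lintegral_filter_of_dominated_convergence
    (μ := (volume : Measure (Edim d))) (l := 𝓝[S] s)
    (F := fun t ξ => ‖f t ξ - f s ξ‖ₑ) (f := fun _ => 0) (fun ξ => 2 * B ξ) ?_ ?_ ?_ ?_
  · rw [lintegral_zero] at key
    exact key
  · exact Eventually.of_forall fun t => ((hm t).sub (hm s)).enorm
  · filter_upwards [self_mem_nhdsWithin] with t ht
    refine Eventually.of_forall fun ξ => enorm_sub_le.trans ?_
    rw [two_mul]
    exact add_le_add (hf t ht ξ) (hf s hs ξ)
  · rw [lintegral_const_mul' _ _ (by norm_num)]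
    exact ENNReal.mul_ne_top (by norm_num) hB
  · refine Eventually.of_forall fun ξ => ?_
    have h : Tendsto (fun t => ‖f t ξ - f s ξ‖ₑ) (𝓝 s) (𝓝 ‖f s ξ - f s ξ‖ₑ) :=
      ((hc ξ).sub continuous_const).enorm.tendsto s
    rw [sub_self, enorm_zero] at h
    exact h.mono_left nhdsWithin_le_nhds

lemma tendsto_FLNorm_Vflow_sub {d : ℕ} {F₀ F₁ : Edim d → ℂ} (h : MemFLPair d F₀ F₁) {T s : ℝ}
    (hT : T ≤ 1) (hs : s ∈ Set.Icc 0 T) :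
    Tendsto (fun t => FLNorm d (fun ξ => Vflow d F₀ F₁ t ξ - Vflow d F₀ F₁ s ξ))
      (𝓝[Set.Icc 0 T] s) (𝓝 0) := by
  have hm := measurable_Vflow_uncurry h.1 h.2.1
  have hB := lintegral_Vflow_bound h.1 F₁
  have hfin : 3 * pairFLNorm d F₀ F₁ ≠ ⊤ := ENNReal.mul_ne_top (by norm_num) h.2.2.ne
  rw [← hB] at hfin
  exact tendsto_FLNorm_sub_of_dominated (f := Vflow d F₀ F₁) hs
    (fun _ => hm.of_uncurry_left) _ hfin
    (fun t ht ξ => enorm_Vflow_le F₀ F₁ ht.1 (ht.2.trans hT) ξ) (continuous_Vflow F₀ F₁)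

/-! ### The Duhamel integral operator -/

/-- Fourier side of `∫₀ᵗ W(t-t') g(t') dt'`. -/
def duhamel (d : ℕ) (g : ℝ → Edim d → ℂ) (t : ℝ) (ξ : Edim d) : ℂ :=
  ∫ t' in (0 : ℝ)..t, ((Wsym (t - t') ‖ξ‖ : ℝ) : ℂ) * g t' ξ

/-- The symbol of `W(t)`, extended by zero to negative times. -/
def WsymPos (t r : ℝ) : ℝ := Wsym (max t 0) r

lemma Wsym_zero (r : ℝ) : Wsym 0 r = 0 := by simp [Wsym, V1sym]

lemma abs_WsymPos_le {T t r : ℝ} (hT : 0 ≤ T) (ht : t ≤ T) (hr : 0 ≤ r) : |WsymPos t r| ≤ T :=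
  (abs_Wsym_le (le_max_right t 0) hr).trans (max_le ht hT)

lemma continuous_WsymPos (r : ℝ) : Continuous fun t => WsymPos t r :=
  (continuous_Wsym r).comp (continuous_id.max continuous_const)

lemma measurable_WsymPos : Measurable (Function.uncurry WsymPos) :=
  measurable_Wsym.comp ((measurable_fst.max measurable_const).prodMk measurable_snd)

lemma measurable_WsymPos_kernel (d : ℕ) (t : ℝ) :
    Measurable fun p : ℝ × Edim d => ((WsymPos (t - p.1) ‖p.2‖ : ℝ) : ℂ) :=
  Complex.measurable_ofReal.comp (measurable_WsymPos.comp
    ((measurable_const.sub measurable_fst).prodMk measurable_snd.norm))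

lemma duhamel_eq_setIntegral {d : ℕ} (g : ℝ → Edim d → ℂ) {T t : ℝ} (ht : t ∈ Set.Icc 0 T)
    (ξ : Edim d) :
    duhamel d g t ξ = ∫ t' in Set.Ioc 0 T, ((WsymPos (t - t') ‖ξ‖ : ℝ) : ℂ) * g t' ξ := by
  rw [duhamel, intervalIntegral.integral_of_le ht.1]
  have h : ∀ t' ∈ Set.Ioc 0 T, ((WsymPos (t - t') ‖ξ‖ : ℝ) : ℂ) * g t' ξ
      = (Set.Ioc 0 t).indicator (fun t' => ((Wsym (t - t') ‖ξ‖ : ℝ) : ℂ) * g t' ξ) t' := by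
    intro t' ht'
    by_cases h : t' ≤ t
    · rw [Set.indicator_of_mem (show t' ∈ Set.Ioc 0 t from ⟨ht'.1, h⟩), WsymPos,
        max_eq_left (sub_nonneg.2 h)]
    · rw [Set.indicator_of_notMem fun hm => h hm.2, WsymPos, max_eq_right (by linarith),
        Wsym_zero, Complex.ofReal_zero, zero_mul]
  rw [setIntegral_congr_fun measurableSet_Ioc h, setIntegral_indicator measurableSet_Ioc,
    Set.inter_eq_right.2 (Set.Ioc_subset_Ioc_right ht.2)]

lemma lintegral_FLNorm_eq_lintegral_prod {d : ℕ} {g : ℝ → Edim d → ℂ}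
    (hg : Measurable (Function.uncurry g)) (S : Set ℝ) :
    ∫⁻ t in S, FLNorm d (g t)
      = ∫⁻ p, ‖Function.uncurry g p‖ₑ ∂((volume.restrict S).prod (volume : Measure (Edim d))) := by
  rw [lintegral_prod _ hg.enorm.aemeasurable]
  rfl

lemma FLNorm_integral_le {d : ℕ} {g : ℝ → Edim d → ℂ}
    (hg : Measurable (Function.uncurry g)) (S : Set ℝ) :
    FLNorm d (fun ξ => ∫ t in S, g t ξ) ≤ ∫⁻ t in S, FLNorm d (g t) := by
  rw [lintegral_FLNorm_eq_lintegral_prod hg, lintegral_prod_symm _ hg.enorm.aemeasurable]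
  exact lintegral_mono fun ξ => enorm_integral_le_lintegral_enorm _

lemma ae_integrableOn_time {d : ℕ} {g : ℝ → Edim d → ℂ}
    (hg : Measurable (Function.uncurry g)) {S : Set ℝ} (hfin : ∫⁻ t in S, FLNorm d (g t) ≠ ⊤) :
    ∀ᵐ ξ : Edim d, IntegrableOn (fun t => g t ξ) S := by
  rw [lintegral_FLNorm_eq_lintegral_prod hg, lintegral_prod_symm _ hg.enorm.aemeasurable] at hfin
  have h := ae_lt_top' (hg.enorm.lintegral_prod_left').aemeasurable hfin
  filter_upwards [h] with ξ hξ
  exact ⟨(hg.comp measurable_prodMk_right).aestronglyMeasurable, hξ⟩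

lemma measurable_WsymPos_mul {d : ℕ} {g : ℝ → Edim d → ℂ}
    (hg : Measurable (Function.uncurry g)) (t : ℝ) :
    Measurable (Function.uncurry fun (t' : ℝ) (ξ : Edim d) =>
      ((WsymPos (t - t') ‖ξ‖ : ℝ) : ℂ) * g t' ξ) :=
  (measurable_WsymPos_kernel d t).mul hg

lemma enorm_WsymPos_le {T t : ℝ} (ht : t ≤ T) {t' : ℝ} (ht' : t' ∈ Set.Ioc 0 T) {r : ℝ}
    (hr : 0 ≤ r) : ‖((WsymPos (t - t') r : ℝ) : ℂ)‖ₑ ≤ ENNReal.ofReal T := by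
  rw [← ofReal_norm, Complex.norm_real]
  exact ENNReal.ofReal_le_ofReal
    (abs_WsymPos_le (ht'.1.le.trans ht'.2) (by linarith [ht'.1]) hr)

lemma lintegral_FLNorm_WsymPos_mul_le {d : ℕ} {g : ℝ → Edim d → ℂ} {T t : ℝ} (ht : t ≤ T) :
    ∫⁻ t' in Set.Ioc 0 T, FLNorm d (fun ξ => ((WsymPos (t - t') ‖ξ‖ : ℝ) : ℂ) * g t' ξ)
      ≤ ENNReal.ofReal T * ∫⁻ t' in Set.Ioc 0 T, FLNorm d (g t') := by
  rw [← lintegral_const_mul' _ _ ENNReal.ofReal_ne_top]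
  refine setLIntegral_mono' measurableSet_Ioc fun t' ht' => ?_
  simp only [FLNorm_eq_lintegral_enorm]
  rw [← lintegral_const_mul' _ _ ENNReal.ofReal_ne_top]
  refine lintegral_mono fun ξ => ?_
  rw [enorm_mul]
  exact mul_le_mul_left (enorm_WsymPos_le ht ht' (norm_nonneg ξ)) _

lemma FLNorm_duhamel_le {d : ℕ} {g : ℝ → Edim d → ℂ}
    (hg : Measurable (Function.uncurry g)) {T t : ℝ} (ht : t ∈ Set.Icc 0 T) :
    FLNorm d (duhamel d g t) ≤ ENNReal.ofReal T * ∫⁻ t' in Set.Ioc 0 T, FLNorm d (g t') := by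
  refine le_trans (le_of_eq ?_) ((FLNorm_integral_le (measurable_WsymPos_mul hg t) _).trans
    (lintegral_FLNorm_WsymPos_mul_le ht.2))
  exact congrArg (FLNorm d) (funext fun ξ => duhamel_eq_setIntegral g ht ξ)

lemma lintegral_FLNorm_le_of_bound {d : ℕ} {g : ℝ → Edim d → ℂ} {T : ℝ} {A : ℝ≥0∞}
    (hA : ∀ t ∈ Set.Icc 0 T, FLNorm d (g t) ≤ A) :
    ∫⁻ t in Set.Ioc 0 T, FLNorm d (g t) ≤ ENNReal.ofReal T * A := by
  refine (setLIntegral_mono' measurableSet_Ioc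
    fun t ht => hA t (Set.Ioc_subset_Icc_self ht)).trans (le_of_eq ?_)
  rw [setLIntegral_const, Real.volume_Ioc, sub_zero, mul_comm]

lemma FLNorm_duhamel_le_of_bound {d : ℕ} {g : ℝ → Edim d → ℂ}
    (hg : Measurable (Function.uncurry g)) {T t : ℝ} (ht : t ∈ Set.Icc 0 T) {A : ℝ≥0∞}
    (hA : ∀ t ∈ Set.Icc 0 T, FLNorm d (g t) ≤ A) :
    FLNorm d (duhamel d g t) ≤ ENNReal.ofReal (T ^ 2) * A := by
  rw [sq, ENNReal.ofReal_mul (ht.1.trans ht.2), mul_assoc]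
  exact (FLNorm_duhamel_le hg ht).trans
    (mul_le_mul_right (lintegral_FLNorm_le_of_bound hA) _)

lemma ae_integrableOn_WsymPos_mul {d : ℕ} {g : ℝ → Edim d → ℂ}
    (hg : Measurable (Function.uncurry g)) {T t : ℝ} (ht : t ≤ T)
    (hfin : ∫⁻ t in Set.Ioc 0 T, FLNorm d (g t) ≠ ⊤) :
    ∀ᵐ ξ : Edim d, IntegrableOn (fun t' => ((WsymPos (t - t') ‖ξ‖ : ℝ) : ℂ) * g t' ξ)
      (Set.Ioc 0 T) :=
  ae_integrableOn_time (measurable_WsymPos_mul hg t)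
    ((lintegral_FLNorm_WsymPos_mul_le ht).trans_lt
      (ENNReal.mul_lt_top ENNReal.ofReal_lt_top hfin.lt_top)).ne

lemma duhamel_sub_ae {d : ℕ} {g h : ℝ → Edim d → ℂ}
    (hg : Measurable (Function.uncurry g)) (hh : Measurable (Function.uncurry h)) {T t : ℝ}
    (ht : t ∈ Set.Icc 0 T) (hgfin : ∫⁻ t in Set.Ioc 0 T, FLNorm d (g t) ≠ ⊤)
    (hhfin : ∫⁻ t in Set.Ioc 0 T, FLNorm d (h t) ≠ ⊤) :
    (fun ξ => duhamel d g t ξ - duhamel d h t ξ)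
      =ᵐ[volume] duhamel d (fun t ξ => g t ξ - h t ξ) t := by
  filter_upwards [ae_integrableOn_WsymPos_mul hg ht.2 hgfin,
    ae_integrableOn_WsymPos_mul hh ht.2 hhfin] with ξ h₁ h₂
  simp only [duhamel_eq_setIntegral _ ht, mul_sub]
  exact (integral_sub h₁ h₂).symm

lemma duhamel_sum_ae {d : ℕ} {ι : Type*} (s : Finset ι) {g : ι → ℝ → Edim d → ℂ}
    (hg : ∀ i ∈ s, Measurable (Function.uncurry (g i))) {T t : ℝ} (ht : t ∈ Set.Icc 0 T)
    (hfin : ∀ i ∈ s, ∫⁻ t in Set.Ioc 0 T, FLNorm d (g i t) ≠ ⊤) :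
    (fun ξ => ∑ i ∈ s, duhamel d (g i) t ξ)
      =ᵐ[volume] duhamel d (fun t ξ => ∑ i ∈ s, g i t ξ) t := by
  have h : ∀ᵐ ξ : Edim d, ∀ i ∈ s, IntegrableOn
      (fun t' => ((WsymPos (t - t') ‖ξ‖ : ℝ) : ℂ) * g i t' ξ) (Set.Ioc 0 T) :=
    (ae_ball_iff s.countable_toSet).2 fun i hi =>
      ae_integrableOn_WsymPos_mul (hg i hi) ht.2 (hfin i hi)
  filter_upwards [h] with ξ hξ
  simp only [duhamel_eq_setIntegral _ ht, Finset.mul_sum]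
  exact (integral_finsetSum s hξ).symm

lemma measurable_duhamel_uncurry {d : ℕ} {g : ℝ → Edim d → ℂ}
    (hg : Measurable (Function.uncurry g)) : Measurable (Function.uncurry (duhamel d g)) := by
  have hk : Measurable fun q : (ℝ × Edim d) × ℝ =>
      ((Wsym (q.1.1 - q.2) ‖q.1.2‖ : ℝ) : ℂ) * g q.2 q.1.2 :=
    (Complex.measurable_ofReal.comp (measurable_Wsym.comp
      (((measurable_fst.comp measurable_fst).sub measurable_snd).prodMk
        (measurable_snd.comp measurable_fst).norm))).mul
      (hg.comp (measurable_snd.prodMk (measurable_snd.comp measurable_fst)))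
  have hI : ∀ S : Set ((ℝ × Edim d) × ℝ), MeasurableSet S →
      Measurable fun p : ℝ × Edim d => ∫ t', S.indicator (fun q =>
        ((Wsym (q.1.1 - q.2) ‖q.1.2‖ : ℝ) : ℂ) * g q.2 q.1.2) (p, t') := fun S hS =>
    ((hk.indicator hS).stronglyMeasurable.integral_prod_right' (ν := volume)).measurable
  have hS₁ : MeasurableSet {q : (ℝ × Edim d) × ℝ | q.2 ∈ Set.Ioc 0 q.1.1} :=
    (measurableSet_lt measurable_const measurable_snd).inter
      (measurableSet_le measurable_snd (measurable_fst.comp measurable_fst))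
  have hS₂ : MeasurableSet {q : (ℝ × Edim d) × ℝ | q.2 ∈ Set.Ioc q.1.1 0} :=
    (measurableSet_lt (measurable_fst.comp measurable_fst) measurable_snd).inter
      (measurableSet_le measurable_snd measurable_const)
  convert (hI _ hS₁).sub (hI _ hS₂) using 1
  ext p
  simp only [Function.uncurry, duhamel, intervalIntegral, Pi.sub_apply]
  rw [← integral_indicator measurableSet_Ioc, ← integral_indicator measurableSet_Ioc]
  rfl

lemma tendsto_FLNorm_duhamel_sub {d : ℕ} {g : ℝ → Edim d → ℂ}
    (hg : Measurable (Function.uncurry g)) {T s : ℝ} (hs : s ∈ Set.Icc 0 T)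
    (hfin : ∫⁻ t in Set.Ioc 0 T, FLNorm d (g t) ≠ ⊤) :
    Tendsto (fun t => FLNorm d (fun ξ => duhamel d g t ξ - duhamel d g s ξ))
      (𝓝[Set.Icc 0 T] s) (𝓝 0) := by
  let μ : Measure (ℝ × Edim d) := (volume.restrict (Set.Ioc 0 T)).prod volume
  let H : ℝ → ℝ → Edim d → ℂ := fun t t' ξ =>
    ((WsymPos (t - t') ‖ξ‖ : ℝ) : ℂ) * g t' ξ - ((WsymPos (s - t') ‖ξ‖ : ℝ) : ℂ) * g t' ξ
  have hH : ∀ t, Measurable (Function.uncurry (H t)) := fun t =>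
    (measurable_WsymPos_mul hg t).sub (measurable_WsymPos_mul hg s)
  have hle : ∀ t ∈ Set.Icc 0 T, FLNorm d (fun ξ => duhamel d g t ξ - duhamel d g s ξ)
      ≤ ∫⁻ p, ‖Function.uncurry (H t) p‖ₑ ∂μ := by
    intro t ht
    rw [← lintegral_FLNorm_eq_lintegral_prod (hH t)]
    refine le_trans (le_of_eq (FLNorm_congr_ae ?_)) (FLNorm_integral_le (hH t) _)
    filter_upwards [ae_integrableOn_WsymPos_mul hg ht.2 hfin,
      ae_integrableOn_WsymPos_mul hg hs.2 hfin] with ξ h₁ h₂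
    simp only [duhamel_eq_setIntegral _ ht, duhamel_eq_setIntegral _ hs]
    exact (integral_sub h₁ h₂).symm
  have key : Tendsto (fun t => ∫⁻ p, ‖Function.uncurry (H t) p‖ₑ ∂μ) (𝓝[Set.Icc 0 T] s)
      (𝓝 (∫⁻ _, 0 ∂μ)) := by
    refine tendsto_lintegral_filter_of_dominated_convergence
      (fun p => 2 * ENNReal.ofReal T * ‖Function.uncurry g p‖ₑ)
      (Eventually.of_forall fun t => (hH t).enorm) ?_ ?_ ?_
    · filter_upwards [self_mem_nhdsWithin] with t ht
      have hmem : ∀ᵐ p ∂μ, p.1 ∈ Set.Ioc 0 T :=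
        Measure.quasiMeasurePreserving_fst.ae (ae_restrict_mem measurableSet_Ioc)
      filter_upwards [hmem] with p hp
      refine enorm_sub_le.trans ?_
      rw [enorm_mul, enorm_mul, ← add_mul, two_mul]
      exact mul_le_mul_left (add_le_add (enorm_WsymPos_le ht.2 hp (norm_nonneg _))
        (enorm_WsymPos_le hs.2 hp (norm_nonneg _))) _
    · rw [lintegral_const_mul' _ _ (ENNReal.mul_ne_top (by norm_num) ENNReal.ofReal_ne_top),
        ← lintegral_FLNorm_eq_lintegral_prod hg]
      exact ENNReal.mul_ne_top (ENNReal.mul_ne_top (by norm_num) ENNReal.ofReal_ne_top) hfin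
    · refine Eventually.of_forall fun p => ?_
      have hc : Continuous fun t => H t p.1 p.2 :=
        ((Complex.continuous_ofReal.comp ((continuous_WsymPos ‖p.2‖).comp
          (continuous_id.sub continuous_const))).mul continuous_const).sub continuous_const
      have h : Tendsto (fun t => ‖H t p.1 p.2‖ₑ) (𝓝 s) (𝓝 ‖H s p.1 p.2‖ₑ) :=
        hc.enorm.tendsto s
      have h0 : H s p.1 p.2 = 0 := sub_self _
      rw [h0, enorm_zero] at h
      exact h.mono_left nhdsWithin_le_nhds
  rw [lintegral_zero] at key
  exact tendsto_of_tendsto_of_tendsto_of_le_of_le' tendsto_const_nhds key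
    (Eventually.of_forall fun _ => zero_le) (eventually_mem_nhdsWithin.mono hle)

/-! ### Sums over tuples and multilinear power series -/

/-- The tuples in `ℕ^k` whose entries sum to less than `n`. -/
def tuplesSumLT (k n : ℕ) : Finset (Fin k → ℕ) :=
  {l ∈ Fintype.piFinset fun _ => Finset.range n | ∑ i, l i < n}

lemma tuplesSumLT_subset (k n : ℕ) :
    tuplesSumLT k n ⊆ Fintype.piFinset fun _ => Finset.range n :=
  Finset.filter_subset _ _

lemma piFinset_range_subset_tuplesSumLT {k n p : ℕ} (h : (k + 1) * p ≤ n) :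
    (Fintype.piFinset fun _ : Fin (k + 1) => Finset.range p) ⊆ tuplesSumLT (k + 1) n := by
  intro l hl
  have hlt : ∀ i, l i < p := fun i => Finset.mem_range.1 (Fintype.mem_piFinset.1 hl i)
  have hsum : ∑ i, l i < n := by
    refine lt_of_lt_of_le (Finset.sum_lt_sum_of_nonempty Finset.univ_nonempty
      fun i _ => hlt i) ?_
    simpa using h
  refine Finset.mem_filter.2 ⟨Fintype.mem_piFinset.2 fun i => Finset.mem_range.2 ?_, hsum⟩
  exact (Finset.single_le_sum (f := l) (fun _ _ => Nat.zero_le _) (Finset.mem_univ i)).trans_lt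
    hsum

lemma sum_range_sum_antidiagonalTuple {M : Type*} [AddCommMonoid M] (k n : ℕ)
    (f : (Fin k → ℕ) → M) :
    ∑ j ∈ Finset.range n, ∑ l ∈ Finset.Nat.antidiagonalTuple k j, f l
      = ∑ l ∈ tuplesSumLT k n, f l := by
  rw [← Finset.sum_fiberwise_of_maps_to (s := tuplesSumLT k n) (t := Finset.range n)
    (g := fun l => ∑ i, l i) fun l hl => Finset.mem_range.2 (Finset.mem_filter.1 hl).2]
  refine Finset.sum_congr rfl fun j hj => Finset.sum_congr ?_ fun _ _ => rfl
  ext l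
  simp only [Finset.Nat.mem_antidiagonalTuple, tuplesSumLT, Finset.mem_filter,
    Fintype.mem_piFinset, Finset.mem_range]
  refine ⟨fun h => ⟨⟨fun i => ?_, ?_⟩, h⟩, fun h => h.2⟩
  · have := Finset.single_le_sum (f := l) (fun _ _ => Nat.zero_le _) (Finset.mem_univ i)
    have := Finset.mem_range.1 hj
    omega
  · have := Finset.mem_range.1 hj
    omega

lemma sum_tuplesSumLT_prod_le {R : Type*} [CommSemiring R] [PartialOrder R] [IsOrderedRing R]
    {a : ℕ → R} (ha : ∀ j, 0 ≤ a j) (k n : ℕ) :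
    ∑ l ∈ tuplesSumLT k n, ∏ i, a (l i) ≤ (∑ j ∈ Finset.range n, a j) ^ k := by
  calc ∑ l ∈ tuplesSumLT k n, ∏ i, a (l i)
      ≤ ∑ l ∈ Fintype.piFinset fun _ : Fin k => Finset.range n, ∏ i, a (l i) :=
        Finset.sum_le_sum_of_subset_of_nonneg (tuplesSumLT_subset k n)
          fun l _ _ => Finset.prod_nonneg fun i _ => ha _
    _ = _ := by rw [← Finset.prod_univ_sum]; simp

lemma sum_range_le_of_recursive_bound {a : ℕ → ℝ≥0∞} {A B τ : ℝ≥0∞} {k : ℕ}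
    (h₀ : a 0 ≤ A)
    (hstep : ∀ j, a (j + 1) ≤ τ * ∑ l ∈ Finset.Nat.antidiagonalTuple k j, ∏ i, a (l i))
    (hAB : A + τ * B ^ k ≤ B) (n : ℕ) : ∑ j ∈ Finset.range n, a j ≤ B := by
  induction n with
  | zero => simp
  | succ n ih =>
    rw [Finset.sum_range_succ', add_comm]
    refine le_trans (add_le_add h₀ ?_) hAB
    calc ∑ j ∈ Finset.range n, a (j + 1)
        ≤ ∑ j ∈ Finset.range n,
            τ * ∑ l ∈ Finset.Nat.antidiagonalTuple k j, ∏ i, a (l i) :=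
          Finset.sum_le_sum fun j _ => hstep j
      _ = τ * ∑ l ∈ tuplesSumLT k n, ∏ i, a (l i) := by
          rw [← Finset.mul_sum, sum_range_sum_antidiagonalTuple]
      _ ≤ τ * B ^ k := by
          gcongr
          exact (sum_tuplesSumLT_prod_le (fun _ => zero_le) k n).trans (by gcongr)

/-- The error bound for truncating the power series of a `k`-linear map at total degree `n`. -/
def powerSeriesError (k : ℕ) (a r : ℕ → ℝ) (S : ℝ) (n : ℕ) : ℝ :=
  k * S ^ (k - 1) * r n
    + ((∑ j ∈ Finset.range n, a j) ^ k - ∑ l ∈ tuplesSumLT k n, ∏ i, a (l i))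

lemma norm_multilinear_sub_sum_le {E : Type*} [NormedAddCommGroup E] [NormedSpace ℂ E] {k : ℕ}
    (L : ContinuousMultilinearMap ℂ (fun _ : Fin k => E) E) (hL : ‖L‖ ≤ 1) {x : ℕ → E} {X : E}
    {a r : ℕ → ℝ} {S : ℝ} (hx : ∀ j, ‖x j‖ ≤ a j)
    (hX : ∀ n, ‖X - ∑ j ∈ Finset.range n, x j‖ ≤ r n) (hS : r 0 ≤ S)
    (haS : ∀ n, ∑ j ∈ Finset.range n, a j ≤ S) (n : ℕ) :
    ‖L (fun _ => X) - ∑ l ∈ tuplesSumLT k n, L (fun i => x (l i))‖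
      ≤ powerSeriesError k a r S n := by
  have ha : ∀ j, 0 ≤ a j := fun j => (norm_nonneg _).trans (hx j)
  have hS0 : 0 ≤ S := by simpa using haS 0
  have hXS : ‖X‖ ≤ S := by simpa using (hX 0).trans hS
  have hsum : ‖∑ j ∈ Finset.range n, x j‖ ≤ S :=
    (norm_sum_le _ _).trans ((Finset.sum_le_sum fun j _ => hx j).trans (haS n))
  have h₁ : ‖L (fun _ => X) - L (fun _ => ∑ j ∈ Finset.range n, x j)‖
      ≤ k * S ^ (k - 1) * r n := by
    refine (L.norm_image_sub_le _ _).trans ?_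
    rw [Fintype.card_fin]
    have hmax : max ‖fun _ : Fin k => X‖ ‖fun _ : Fin k => ∑ j ∈ Finset.range n, x j‖ ≤ S :=
      max_le ((pi_norm_const_le _).trans hXS) ((pi_norm_const_le _).trans hsum)
    have hdiff : ‖(fun _ : Fin k => X) - fun _ : Fin k => ∑ j ∈ Finset.range n, x j‖ ≤ r n :=
      (pi_norm_const_le (X - ∑ j ∈ Finset.range n, x j)).trans (hX n)
    calc _ ≤ 1 * (k : ℝ) * S ^ (k - 1) * r n := by gcongr
      _ = _ := by ring
  have h₂ : ‖L (fun _ => ∑ j ∈ Finset.range n, x j)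
      - ∑ l ∈ tuplesSumLT k n, L (fun i => x (l i))‖
      ≤ (∑ j ∈ Finset.range n, a j) ^ k - ∑ l ∈ tuplesSumLT k n, ∏ i, a (l i) := by
    have hpow : (∑ j ∈ Finset.range n, a j) ^ k
        = ∑ l ∈ Fintype.piFinset fun _ : Fin k => Finset.range n, ∏ i, a (l i) := by
      rw [← Finset.prod_univ_sum]; simp
    rw [L.map_sum_finset (fun _ => x) (fun _ => Finset.range n), hpow,
      ← Finset.sum_sdiff (tuplesSumLT_subset k n), add_sub_cancel_right,
      ← Finset.sum_sdiff (tuplesSumLT_subset k n), add_sub_cancel_right]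
    refine norm_sum_le_of_le _ fun l _ => (L.le_opNorm _).trans ?_
    calc ‖L‖ * ∏ i, ‖x (l i)‖ ≤ 1 * ∏ i, a (l i) := by
          gcongr
          exact hx _
      _ = _ := one_mul _
  exact (norm_sub_le_norm_sub_add_norm_sub _ _ _).trans (add_le_add h₁ h₂)

lemma tendsto_powerSeriesError {k : ℕ} {a r : ℕ → ℝ} {S : ℝ} (ha : ∀ j, 0 ≤ a j)
    (haS : ∀ n, ∑ j ∈ Finset.range n, a j ≤ S) (hr : Tendsto r atTop (𝓝 0)) :
    Tendsto (powerSeriesError (k + 1) a r S) atTop (𝓝 0) := by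
  have hsum : Summable a := summable_of_sum_range_le ha haS
  have hpow := (hsum.hasSum.tendsto_sum_nat).pow (k + 1)
  have hdiv : Tendsto (fun n : ℕ => n / (k + 1)) atTop atTop :=
    Nat.tendsto_div_const_atTop (Nat.succ_ne_zero k)
  have hB : Tendsto (fun n => ∑ l ∈ tuplesSumLT (k + 1) n, ∏ i, a (l i)) atTop
      (𝓝 ((∑' j, a j) ^ (k + 1))) := by
    refine tendsto_of_tendsto_of_tendsto_of_le_of_le (hpow.comp hdiv) hpow (fun n => ?_)
      fun n => sum_tuplesSumLT_prod_le ha (k + 1) n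
    have : (∑ j ∈ Finset.range (n / (k + 1)), a j) ^ (k + 1)
        = ∑ l ∈ Fintype.piFinset fun _ : Fin (k + 1) => Finset.range (n / (k + 1)),
            ∏ i, a (l i) := by
      rw [← Finset.prod_univ_sum]; simp
    simp only [Function.comp_apply, this]
    exact Finset.sum_le_sum_of_subset_of_nonneg
      (piFinset_range_subset_tuplesSumLT (Nat.mul_div_le n (k + 1)))
      fun l _ _ => Finset.prod_nonneg fun i _ => ha _
  have := (hr.const_mul (((k + 1 : ℕ) : ℝ) * S ^ (k + 1 - 1))).add (hpow.sub hB)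
  rw [sub_self, mul_zero, add_zero] at this
  exact this

lemma FLNorm_sub_eq_ofReal_norm {d : ℕ} {f g : Edim d → ℂ} (hf : Integrable f volume)
    (hg : Integrable g volume) :
    FLNorm d (fun ξ => f ξ - g ξ)
      = ENNReal.ofReal ‖(hf.toL1 f - hg.toL1 g : FreqL1 d)‖ := by
  rw [← Integrable.toL1_sub f g hf hg, ofReal_norm, Integrable.enorm_toL1]
  rfl

lemma toL1_sum {d : ℕ} {ι : Type*} (s : Finset ι) {f : ι → Edim d → ℂ}
    (hf : ∀ i, Integrable (f i)) :
    (integrable_finsetSum s fun i _ => hf i).toL1 (fun ξ => ∑ i ∈ s, f i ξ)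
      = ∑ i ∈ s, (hf i).toL1 (f i) := by
  classical
  induction s using Finset.induction_on with
  | empty => simp only [Finset.sum_empty]; exact Integrable.toL1_zero _
  | insert i s hi ih =>
    rw [Finset.sum_insert hi, ← ih, ← Integrable.toL1_add, Integrable.toL1_eq_toL1_iff]
    exact Eventually.of_forall fun ξ => Finset.sum_insert hi

lemma FLNorm_listConv_sub_sum_le {d k : ℕ} {f : ℕ → Edim d → ℂ} {F : Edim d → ℂ}
    (hf : ∀ j, Measurable (f j)) (hF : Measurable F) {a r : ℕ → ℝ} {S : ℝ}
    (ha : ∀ j, 0 ≤ a j) (hfa : ∀ j, FLNorm d (f j) ≤ ENNReal.ofReal (a j))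
    (hr : ∀ n, 0 ≤ r n)
    (hFr : ∀ n, FLNorm d (fun ξ => F ξ - ∑ j ∈ Finset.range n, f j ξ) ≤ ENNReal.ofReal (r n))
    (hS : r 0 ≤ S) (haS : ∀ n, ∑ j ∈ Finset.range n, a j ≤ S) (n : ℕ) :
    FLNorm d (fun ξ => listConv d (List.ofFn fun _ : Fin (k + 1) => F) ξ
        - ∑ l ∈ tuplesSumLT (k + 1) n, listConv d (List.ofFn fun i => f (l i)) ξ)
      ≤ ENNReal.ofReal (powerSeriesError (k + 1) a r S n) := by
  have hfi : ∀ j, Integrable (f j) := fun j =>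
    integrable_of_FLNorm_lt_top (hf j) ((hfa j).trans_lt ENNReal.ofReal_lt_top)
  have hFi : Integrable F := integrable_of_FLNorm_lt_top hF
    (lt_of_le_of_lt (by simpa using hFr 0) ENNReal.ofReal_lt_top)
  have hsi : ∀ n, Integrable (fun ξ => ∑ j ∈ Finset.range n, f j ξ) := fun n =>
    integrable_finsetSum _ fun j _ => hfi j
  let x : ℕ → FreqL1 d := fun j => (hfi j).toL1 (f j)
  let X : FreqL1 d := hFi.toL1 F
  have hterm : ∀ l : Fin (k + 1) → ℕ, Integrable (listConv d (List.ofFn fun i => f (l i))) :=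
    fun l => integrable_listConv fun i => hfi (l i)
  have hF' : Integrable (listConv d (List.ofFn fun _ : Fin (k + 1) => F)) :=
    integrable_listConv fun _ => hFi
  have hsum : (integrable_finsetSum (tuplesSumLT (k + 1) n) fun l _ => hterm l).toL1
      (fun ξ => ∑ l ∈ tuplesSumLT (k + 1) n, listConv d (List.ofFn fun i => f (l i)) ξ)
      = ∑ l ∈ tuplesSumLT (k + 1) n, convMultilinear d k fun i => x (l i) :=
    (toL1_sum _ hterm).trans (Finset.sum_congr rfl fun l _ =>
      (convMultilinear_toL1 (f := fun i => f (l i)) fun i => hfi (l i)).symm)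
  have hX : hF'.toL1 _ = convMultilinear d k fun _ => X :=
    (convMultilinear_toL1 (f := fun _ => F) fun _ => hFi).symm
  rw [FLNorm_sub_eq_ofReal_norm hF' (integrable_finsetSum _ fun l _ => hterm l), hsum, hX]
  refine ENNReal.ofReal_le_ofReal (norm_multilinear_sub_sum_le (convMultilinear d k)
    (norm_convMultilinear_le d k) (x := x) (fun j => ?_) (fun n => ?_) hS haS n)
  · rw [← ENNReal.ofReal_le_ofReal_iff (ha j), ofReal_norm, Integrable.enorm_toL1]
    exact hfa j
  · rw [← ENNReal.ofReal_le_ofReal_iff (hr n), ← toL1_sum,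
      ← FLNorm_sub_eq_ofReal_norm hFi (hsi n)]
    exact hFr n

lemma FLNorm_sum_sub_limUnder_le {d : ℕ} {f : ℕ → Edim d → ℂ} (hf : ∀ j, Measurable (f j))
    (hfin : ∑' j, FLNorm d (f j) ≠ ⊤) (n : ℕ) :
    FLNorm d (fun ξ => (∑ j ∈ Finset.range n, f j ξ)
        - limUnder atTop fun n => ∑ j ∈ Finset.range n, f j ξ)
      ≤ ∑' j, FLNorm d (f (j + n)) := by
  simp only [FLNorm_eq_lintegral_enorm] at hfin ⊢
  rw [← lintegral_tsum fun j => (hf j).enorm.aemeasurable] at hfin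
  rw [← lintegral_tsum fun j => (hf (j + n)).enorm.aemeasurable]
  have h := ae_lt_top' (Measurable.tsum fun j => (hf j).enorm).aemeasurable hfin
  refine lintegral_mono_ae (h.mono fun ξ hξ => ?_)
  have hs : Summable fun j => f j ξ := by
    refine Summable.of_enorm hξ.ne
  rw [hs.hasSum.tendsto_sum_nat.limUnder_eq, ← hs.sum_add_tsum_nat_add n, sub_add_cancel_left,
    enorm_neg]
  exact enorm_tsum_le_tsum_enorm

/-! ### Picard iterates and existence -/

lemma Xi_zero (d k : ℕ) (F₀ F₁ : Edim d → ℂ) : Xi d k F₀ F₁ 0 = Vflow d F₀ F₁ := by rw [Xi]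

/-- The product of Picard iterates of indices `l`, on the Fourier side. -/
def XiProd (d k : ℕ) (F₀ F₁ : Edim d → ℂ) (l : Fin k → ℕ) (t : ℝ) : Edim d → ℂ :=
  listConv d (List.ofFn fun i => Xi d k F₀ F₁ (l i) t)

lemma Xi_succ (d k : ℕ) (F₀ F₁ : Edim d → ℂ) (j : ℕ) (t : ℝ) (ξ : Edim d) :
    Xi d k F₀ F₁ (j + 1) t ξ = -∑ l ∈ Finset.Nat.antidiagonalTuple k j,
      duhamel d (XiProd d k F₀ F₁ l) t ξ := by
  rw [Xi]
  beta_reduce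
  rw [Finset.sum_attach (Finset.Nat.antidiagonalTuple k j)
    fun l => Ik d k (fun i => Xi d k F₀ F₁ (l i)) t ξ, ← Finset.sum_neg_distrib]
  rfl

lemma measurable_Xi_uncurry {d : ℕ} (m : ℕ) {F₀ F₁ : Edim d → ℂ} (h₀ : Measurable F₀)
    (h₁ : Measurable F₁) (j : ℕ) : Measurable (Function.uncurry (Xi d (m + 1) F₀ F₁ j)) := by
  induction j using Nat.strong_induction_on with
  | _ j ih =>
    cases j with
    | zero => rw [Xi_zero]; exact measurable_Vflow_uncurry h₀ h₁
    | succ j =>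
      have h : Function.uncurry (Xi d (m + 1) F₀ F₁ (j + 1)) = fun p =>
          -∑ l ∈ Finset.Nat.antidiagonalTuple (m + 1) j,
            Function.uncurry (duhamel d (XiProd d (m + 1) F₀ F₁ l)) p :=
        funext fun p => Xi_succ d (m + 1) F₀ F₁ j p.1 p.2
      rw [h]
      refine (Finset.measurable_fun_sum _ fun l hl => ?_).neg
      refine measurable_duhamel_uncurry (measurable_listConv_uncurry fun i => ih _ ?_)
      have h := Finset.single_le_sum (f := l) (fun _ _ => Nat.zero_le _) (Finset.mem_univ i)
      rw [Finset.Nat.mem_antidiagonalTuple.1 hl] at h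
      omega

lemma measurable_XiProd_uncurry {d m : ℕ} {F₀ F₁ : Edim d → ℂ} (h₀ : Measurable F₀)
    (h₁ : Measurable F₁) (l : Fin (m + 1) → ℕ) :
    Measurable (Function.uncurry (XiProd d (m + 1) F₀ F₁ l)) :=
  measurable_listConv_uncurry fun i => measurable_Xi_uncurry m h₀ h₁ (l i)

/-- The norm of the `j`-th Picard iterate in `C([0,T]; FL^{0,1})`. -/
def XiSup (d k : ℕ) (F₀ F₁ : Edim d → ℂ) (T : ℝ) (j : ℕ) : ℝ≥0∞ :=
  ⨆ t ∈ Set.Icc 0 T, FLNorm d (Xi d k F₀ F₁ j t)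

lemma FLNorm_Xi_le (d k : ℕ) (F₀ F₁ : Edim d → ℂ) {T t : ℝ} (ht : t ∈ Set.Icc 0 T) (j : ℕ) :
    FLNorm d (Xi d k F₀ F₁ j t) ≤ XiSup d k F₀ F₁ T j :=
  le_iSup₂ (f := fun t (_ : t ∈ Set.Icc 0 T) => FLNorm d (Xi d k F₀ F₁ j t)) t ht

lemma FLNorm_XiProd_le {d m : ℕ} {F₀ F₁ : Edim d → ℂ} (h₀ : Measurable F₀)
    (h₁ : Measurable F₁) {T t : ℝ} (ht : t ∈ Set.Icc 0 T) (l : Fin (m + 1) → ℕ) :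
    FLNorm d (XiProd d (m + 1) F₀ F₁ l t) ≤ ∏ i, XiSup d (m + 1) F₀ F₁ T (l i) :=
  (FLNorm_listConv_le fun i => (measurable_Xi_uncurry m h₀ h₁ (l i)).of_uncurry_left).trans
    (Finset.prod_le_prod' fun i _ => FLNorm_Xi_le d (m + 1) F₀ F₁ ht (l i))

lemma XiSup_zero_le {d : ℕ} (m : ℕ) {F₀ F₁ : Edim d → ℂ} (h₀ : Measurable F₀) {T : ℝ}
    (hT : T ≤ 1) : XiSup d (m + 1) F₀ F₁ T 0 ≤ 3 * pairFLNorm d F₀ F₁ := by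
  rw [XiSup, Xi_zero]
  exact iSup₂_le fun t ht => FLNorm_Vflow_le h₀ ht.1 (ht.2.trans hT)

lemma XiSup_succ_le {d m : ℕ} {F₀ F₁ : Edim d → ℂ} (h₀ : Measurable F₀) (h₁ : Measurable F₁)
    (T : ℝ) (j : ℕ) : XiSup d (m + 1) F₀ F₁ T (j + 1) ≤ ENNReal.ofReal (T ^ 2) *
      ∑ l ∈ Finset.Nat.antidiagonalTuple (m + 1) j, ∏ i, XiSup d (m + 1) F₀ F₁ T (l i) := by
  refine iSup₂_le fun t ht => ?_
  have h : FLNorm d (Xi d (m + 1) F₀ F₁ (j + 1) t) = FLNorm d (fun ξ =>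
      ∑ l ∈ Finset.Nat.antidiagonalTuple (m + 1) j, duhamel d (XiProd d (m + 1) F₀ F₁ l) t ξ) := by
    simp only [FLNorm_eq_lintegral_enorm, Xi_succ, enorm_neg]
  rw [h, Finset.mul_sum]
  refine (FLNorm_sum_le _ fun l _ =>
    (measurable_duhamel_uncurry (measurable_XiProd_uncurry h₀ h₁ l)).of_uncurry_left).trans
    (Finset.sum_le_sum fun l _ => ?_)
  exact FLNorm_duhamel_le_of_bound (measurable_XiProd_uncurry h₀ h₁ l) ht
    fun t ht => FLNorm_XiProd_le h₀ h₁ ht l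

lemma tsum_XiSup_le {d m : ℕ} {F₀ F₁ : Edim d → ℂ} (h₀ : Measurable F₀) (h₁ : Measurable F₁)
    {T : ℝ} (hT : T ≤ 1) {A B : ℝ≥0∞} (hA : 3 * pairFLNorm d F₀ F₁ ≤ A)
    (hAB : A + ENNReal.ofReal (T ^ 2) * B ^ (m + 1) ≤ B) : ∑' j, XiSup d (m + 1) F₀ F₁ T j ≤ B :=
  ENNReal.tsum_le_of_sum_range_le (sum_range_le_of_recursive_bound
    ((XiSup_zero_le m h₀ hT).trans hA) (XiSup_succ_le h₀ h₁ T) hAB)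

/-- The pointwise sum of the power series of Picard iterates. -/
def XiLim (d k : ℕ) (F₀ F₁ : Edim d → ℂ) (t : ℝ) (ξ : Edim d) : ℂ :=
  limUnder atTop fun n => ∑ j ∈ Finset.range n, Xi d k F₀ F₁ j t ξ

lemma measurable_XiLim_uncurry {d : ℕ} (m : ℕ) {F₀ F₁ : Edim d → ℂ} (h₀ : Measurable F₀)
    (h₁ : Measurable F₁) : Measurable (Function.uncurry (XiLim d (m + 1) F₀ F₁)) := by
  have h : ∀ n : ℕ, StronglyMeasurable fun p : ℝ × Edim d =>
      ∑ j ∈ Finset.range n, Xi d (m + 1) F₀ F₁ j p.1 p.2 := fun n =>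
    (Finset.measurable_fun_sum _ fun j _ => measurable_Xi_uncurry m h₀ h₁ j).stronglyMeasurable
  exact (StronglyMeasurable.limUnder h).measurable

lemma measurable_Xi {d : ℕ} (m : ℕ) {F₀ F₁ : Edim d → ℂ} (h₀ : Measurable F₀)
    (h₁ : Measurable F₁) (j : ℕ) (t : ℝ) : Measurable (Xi d (m + 1) F₀ F₁ j t) :=
  (measurable_Xi_uncurry m h₀ h₁ j).of_uncurry_left

lemma measurable_XiLim {d : ℕ} (m : ℕ) {F₀ F₁ : Edim d → ℂ} (h₀ : Measurable F₀)
    (h₁ : Measurable F₁) (t : ℝ) : Measurable (XiLim d (m + 1) F₀ F₁ t) :=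
  (measurable_XiLim_uncurry m h₀ h₁).of_uncurry_left

lemma FLNorm_sum_Xi_sub_XiLim_le {d m : ℕ} {F₀ F₁ : Edim d → ℂ} (h₀ : Measurable F₀)
    (h₁ : Measurable F₁) {T t : ℝ} (hfin : ∑' j, XiSup d (m + 1) F₀ F₁ T j ≠ ⊤)
    (ht : t ∈ Set.Icc 0 T) (n : ℕ) :
    FLNorm d (fun ξ => (∑ j ∈ Finset.range n, Xi d (m + 1) F₀ F₁ j t ξ) - XiLim d (m + 1) F₀ F₁ t ξ)
      ≤ ∑' j, XiSup d (m + 1) F₀ F₁ T (j + n) := by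
  have hle : ∀ n, ∑' j, FLNorm d (Xi d (m + 1) F₀ F₁ (j + n) t)
      ≤ ∑' j, XiSup d (m + 1) F₀ F₁ T (j + n) :=
    fun n => ENNReal.tsum_le_tsum fun j => FLNorm_Xi_le d (m + 1) F₀ F₁ ht _
  exact (FLNorm_sum_sub_limUnder_le (fun j => measurable_Xi m h₀ h₁ j t)
    ((hle 0).trans_lt hfin.lt_top).ne n).trans (hle n)

lemma FLNorm_XiLim_le {d m : ℕ} {F₀ F₁ : Edim d → ℂ} (h₀ : Measurable F₀)
    (h₁ : Measurable F₁) {T t : ℝ} (hfin : ∑' j, XiSup d (m + 1) F₀ F₁ T j ≠ ⊤)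
    (ht : t ∈ Set.Icc 0 T) :
    FLNorm d (XiLim d (m + 1) F₀ F₁ t) ≤ ∑' j, XiSup d (m + 1) F₀ F₁ T j := by
  refine le_trans (le_of_eq ?_) (FLNorm_sum_Xi_sub_XiLim_le h₀ h₁ hfin ht 0)
  simp [FLNorm_eq_lintegral_enorm]

lemma tendsto_iSup_FLNorm_sum_Xi_sub_XiLim {d m : ℕ} {F₀ F₁ : Edim d → ℂ} (h₀ : Measurable F₀)
    (h₁ : Measurable F₁) {T : ℝ} (hfin : ∑' j, XiSup d (m + 1) F₀ F₁ T j ≠ ⊤) :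
    Tendsto (fun n : ℕ => ⨆ t ∈ Set.Icc (0 : ℝ) T,
      FLNorm d (fun ξ => (∑ j ∈ Finset.range n, Xi d (m + 1) F₀ F₁ j t ξ)
        - XiLim d (m + 1) F₀ F₁ t ξ))
      atTop (𝓝 0) :=
  tendsto_of_tendsto_of_tendsto_of_le_of_le tendsto_const_nhds
    (ENNReal.tendsto_sum_nat_add _ hfin) (fun _ => zero_le)
    fun n => iSup₂_le fun _ ht => FLNorm_sum_Xi_sub_XiLim_le h₀ h₁ hfin ht n

/-- The `k`-fold convolution power of a time-dependent function. -/
def convPow (d k : ℕ) (u : ℝ → Edim d → ℂ) (t : ℝ) : Edim d → ℂ :=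
  listConv d (List.ofFn fun _ : Fin k => u t)

lemma measurable_convPow_uncurry {d : ℕ} (m : ℕ) {u : ℝ → Edim d → ℂ}
    (hu : Measurable (Function.uncurry u)) : Measurable (Function.uncurry (convPow d (m + 1) u)) :=
  measurable_listConv_uncurry fun _ => hu

lemma FLNorm_convPow_le {d : ℕ} (m : ℕ) {u : ℝ → Edim d → ℂ} {t : ℝ} (hu : Measurable (u t)) :
    FLNorm d (convPow d (m + 1) u t) ≤ FLNorm d (u t) ^ (m + 1) :=
  (FLNorm_listConv_le (d := d) (m := m) (f := fun _ : Fin (m + 1) => u t)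
    fun _ => hu).trans_eq (by simp)

lemma sum_range_succ_Xi_ae {d m : ℕ} {F₀ F₁ : Edim d → ℂ} (h₀ : Measurable F₀)
    (h₁ : Measurable F₁) {T t : ℝ} (hfin : ∀ j, XiSup d (m + 1) F₀ F₁ T j ≠ ⊤)
    (ht : t ∈ Set.Icc 0 T) (n : ℕ) :
    (fun ξ => ∑ j ∈ Finset.range (n + 1), Xi d (m + 1) F₀ F₁ j t ξ) =ᵐ[volume] fun ξ =>
      Vflow d F₀ F₁ t ξ
        - duhamel d (fun t ξ => ∑ l ∈ tuplesSumLT (m + 1) n, XiProd d (m + 1) F₀ F₁ l t ξ) t ξ := by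
  have hprod : ∀ l : Fin (m + 1) → ℕ,
      ∫⁻ t in Set.Ioc 0 T, FLNorm d (XiProd d (m + 1) F₀ F₁ l t) ≠ ⊤ := fun l =>
    ((lintegral_FLNorm_le_of_bound fun t ht => FLNorm_XiProd_le h₀ h₁ ht l).trans_lt
      (ENNReal.mul_lt_top ENNReal.ofReal_lt_top
        (ENNReal.prod_lt_top fun i _ => (hfin (l i)).lt_top))).ne
  filter_upwards [duhamel_sum_ae (tuplesSumLT (m + 1) n)
    (fun l _ => measurable_XiProd_uncurry h₀ h₁ l) ht fun l _ => hprod l] with ξ hξ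
  rw [← hξ, Finset.sum_range_succ', Xi_zero, ← sum_range_sum_antidiagonalTuple]
  simp only [Xi_succ, Finset.sum_neg_distrib]
  ring

lemma exists_FLNorm_convPow_XiLim_sub_le {d m : ℕ} {F₀ F₁ : Edim d → ℂ} (h₀ : Measurable F₀)
    (h₁ : Measurable F₁) {T : ℝ} (hfin : ∑' j, XiSup d (m + 1) F₀ F₁ T j ≠ ⊤) :
    ∃ ε : ℕ → ℝ, Tendsto ε atTop (𝓝 0) ∧ ∀ t ∈ Set.Icc 0 T, ∀ n,
      FLNorm d (fun ξ => convPow d (m + 1) (XiLim d (m + 1) F₀ F₁) t ξ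
        - ∑ l ∈ tuplesSumLT (m + 1) n, XiProd d (m + 1) F₀ F₁ l t ξ)
      ≤ ENNReal.ofReal (ε n) := by
  set a := XiSup d (m + 1) F₀ F₁ T
  have ha : ∀ j, a j ≠ ⊤ := ENNReal.ne_top_of_tsum_ne_top hfin
  have hrfin : ∀ n, ∑' j, a (j + n) ≠ ⊤ := fun n =>
    ((ENNReal.tsum_comp_le_tsum_of_injective (add_left_injective n) a).trans_lt hfin.lt_top).ne
  let r : ℕ → ℝ := fun n => (∑' j, a (j + n)).toReal
  have hr : Tendsto r atTop (𝓝 0) :=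
    (ENNReal.tendsto_toReal ENNReal.zero_ne_top).comp (ENNReal.tendsto_sum_nat_add a hfin)
  have haS : ∀ n, ∑ j ∈ Finset.range n, (a j).toReal ≤ r 0 := fun n => by
    rw [← ENNReal.toReal_sum fun j _ => ha j]
    exact ENNReal.toReal_mono (hrfin 0) (ENNReal.sum_le_tsum _)
  refine ⟨powerSeriesError (m + 1) (fun j => (a j).toReal) r (r 0),
    tendsto_powerSeriesError (fun j => ENNReal.toReal_nonneg) haS hr, fun t ht n => ?_⟩
  refine FLNorm_listConv_sub_sum_le (k := m) (r := r) (f := fun j => Xi d (m + 1) F₀ F₁ j t)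
    (F := XiLim d (m + 1) F₀ F₁ t) (fun j => measurable_Xi m h₀ h₁ j t)
    (measurable_XiLim m h₀ h₁ t) (fun j => ENNReal.toReal_nonneg) (fun j => ?_)
    (fun n => ENNReal.toReal_nonneg) (fun n => ?_) le_rfl haS n
  · rw [ENNReal.ofReal_toReal (ha j)]
    exact FLNorm_Xi_le d _ F₀ F₁ ht j
  · rw [ENNReal.ofReal_toReal (hrfin n), FLNorm_sub_comm]
    exact FLNorm_sum_Xi_sub_XiLim_le h₀ h₁ hfin ht n

lemma ae_eq_of_FLNorm_sub_eq_zero {d : ℕ} {F G : Edim d → ℂ} (hF : Measurable F)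
    (hG : Measurable G) (h : FLNorm d (fun ξ => F ξ - G ξ) = 0) : F =ᵐ[volume] G := by
  have h' := (lintegral_eq_zero_iff (hF.sub hG).enorm).1 h
  exact h'.mono fun ξ hξ => sub_eq_zero.1 (enorm_eq_zero.1 hξ)

lemma lintegral_FLNorm_convPow_ne_top {d : ℕ} (m : ℕ) {u : ℝ → Edim d → ℂ} {T : ℝ} {B : ℝ≥0∞}
    (hu : ∀ t ∈ Set.Icc 0 T, Measurable (u t)) (hB : B ≠ ⊤)
    (huB : ∀ t ∈ Set.Icc 0 T, FLNorm d (u t) ≤ B) :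
    ∫⁻ t in Set.Ioc 0 T, FLNorm d (convPow d (m + 1) u t) ≠ ⊤ :=
  ((lintegral_FLNorm_le_of_bound fun t ht => (FLNorm_convPow_le m (hu t ht)).trans
    (pow_le_pow_left' (huB t ht) (m + 1))).trans_lt
      (ENNReal.mul_lt_top ENNReal.ofReal_lt_top (ENNReal.pow_lt_top hB.lt_top))).ne

lemma XiLim_ae_eq {d m : ℕ} {F₀ F₁ : Edim d → ℂ} (h₀ : Measurable F₀) (h₁ : Measurable F₁)
    {T t : ℝ} (hfin : ∑' j, XiSup d (m + 1) F₀ F₁ T j ≠ ⊤) (ht : t ∈ Set.Icc 0 T) :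
    XiLim d (m + 1) F₀ F₁ t =ᵐ[volume] fun ξ => Vflow d F₀ F₁ t ξ
      - duhamel d (convPow d (m + 1) (XiLim d (m + 1) F₀ F₁)) t ξ := by
  set u := XiLim d (m + 1) F₀ F₁
  let N : ℕ → ℝ → Edim d → ℂ := fun n t ξ =>
    ∑ l ∈ tuplesSumLT (m + 1) n, XiProd d (m + 1) F₀ F₁ l t ξ
  have hum : Measurable (Function.uncurry (convPow d (m + 1) u)) :=
    measurable_convPow_uncurry m (measurable_XiLim_uncurry m h₀ h₁)
  have hNm : ∀ n, Measurable (Function.uncurry (N n)) := fun n =>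
    Finset.measurable_fun_sum _ fun l _ => measurable_XiProd_uncurry h₀ h₁ l
  have hufin : ∫⁻ t in Set.Ioc 0 T, FLNorm d (convPow d (m + 1) u t) ≠ ⊤ :=
    lintegral_FLNorm_convPow_ne_top m (fun t _ => measurable_XiLim m h₀ h₁ t) hfin
      fun t ht => FLNorm_XiLim_le h₀ h₁ hfin ht
  have hXfin : ∀ j, XiSup d (m + 1) F₀ F₁ T j ≠ ⊤ := ENNReal.ne_top_of_tsum_ne_top hfin
  have hNfin : ∀ n, ∫⁻ t in Set.Ioc 0 T, FLNorm d (N n t) ≠ ⊤ := fun n => by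
    refine ((lintegral_FLNorm_le_of_bound
      (A := ∑ l ∈ tuplesSumLT (m + 1) n, ∏ i, XiSup d (m + 1) F₀ F₁ T (l i)) fun t ht =>
        (FLNorm_sum_le _ fun l _ => (measurable_XiProd_uncurry h₀ h₁ l).of_uncurry_left).trans
          (Finset.sum_le_sum fun l _ => FLNorm_XiProd_le h₀ h₁ ht l)).trans_lt
      (ENNReal.mul_lt_top ENNReal.ofReal_lt_top (ENNReal.sum_lt_top.2 fun l _ =>
        ENNReal.prod_lt_top fun i _ => (hXfin (l i)).lt_top))).ne
  obtain ⟨ε, hε, hle⟩ := exists_FLNorm_convPow_XiLim_sub_le h₀ h₁ hfin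
  have hVm : Measurable (Vflow d F₀ F₁ t) := (measurable_Vflow_uncurry h₀ h₁).of_uncurry_left
  have hDm : Measurable (duhamel d (convPow d (m + 1) u) t) :=
    (measurable_duhamel_uncurry hum).of_uncurry_left
  refine ae_eq_of_FLNorm_sub_eq_zero (measurable_XiLim m h₀ h₁ t) (hVm.sub hDm)
    (le_antisymm ?_ zero_le)
  have hlim : Tendsto (fun n => ∑' j, XiSup d (m + 1) F₀ F₁ T (j + (n + 1))
      + ENNReal.ofReal (T ^ 2) * ENNReal.ofReal (ε n)) atTop (𝓝 0) := by
    have h₁ := ((tendsto_add_atTop_iff_nat 1).2 (ENNReal.tendsto_sum_nat_add _ hfin)).add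
      (ENNReal.Tendsto.const_mul (a := ENNReal.ofReal (T ^ 2)) (ENNReal.tendsto_ofReal hε)
        (Or.inr ENNReal.ofReal_ne_top))
    simpa using h₁
  refine ge_of_tendsto' hlim fun n => ?_
  have hSm : Measurable fun ξ => ∑ j ∈ Finset.range (n + 1), Xi d (m + 1) F₀ F₁ j t ξ :=
    Finset.measurable_fun_sum _ fun j _ => measurable_Xi m h₀ h₁ j t
  refine (FLNorm_sub_le (measurable_XiLim m h₀ h₁ t) hSm).trans (add_le_add ?_ ?_)
  · rw [FLNorm_sub_comm]
    exact FLNorm_sum_Xi_sub_XiLim_le h₀ h₁ hfin ht (n + 1)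
  · have hae : (fun ξ => (∑ j ∈ Finset.range (n + 1), Xi d (m + 1) F₀ F₁ j t ξ)
        - (Vflow d F₀ F₁ t ξ - duhamel d (convPow d (m + 1) u) t ξ))
        =ᵐ[volume] duhamel d (fun t ξ => convPow d (m + 1) u t ξ - N n t ξ) t := by
      filter_upwards [sum_range_succ_Xi_ae h₀ h₁ hXfin ht n,
        duhamel_sub_ae hum (hNm n) ht hufin (hNfin n)] with ξ e₁ e₂
      rw [e₁, ← e₂]
      ring
    rw [FLNorm_congr_ae hae]
    exact FLNorm_duhamel_le_of_bound (hum.sub (hNm n)) ht fun t ht => hle t ht n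

lemma isDuhamelSolution_of_ae_eq {d m : ℕ} {F₀ F₁ : Edim d → ℂ} (h : MemFLPair d F₀ F₁)
    {T : ℝ} (hT : T ≤ 1) {u : ℝ → Edim d → ℂ} (hu : Measurable (Function.uncurry u))
    {B : ℝ≥0∞} (hB : B ≠ ⊤) (huB : ∀ t ∈ Set.Icc 0 T, FLNorm d (u t) ≤ B)
    (hae : ∀ t ∈ Set.Icc 0 T, u t =ᵐ[volume] fun ξ => Vflow d F₀ F₁ t ξ
      - duhamel d (convPow d (m + 1) u) t ξ) : IsDuhamelSolution d (m + 1) T F₀ F₁ u where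
  measurable t _ := hu.of_uncurry_left
  finite t ht := (huB t ht).trans_lt hB.lt_top
  continuous := by
    intro s hs ε hε
    have hum : Measurable (Function.uncurry (convPow d (m + 1) u)) :=
      measurable_convPow_uncurry m hu
    have hVm : ∀ t, Measurable (Vflow d F₀ F₁ t) := fun t =>
      (measurable_Vflow_uncurry h.1 h.2.1).of_uncurry_left
    have hlim := (tendsto_FLNorm_Vflow_sub h hT hs).add
      (tendsto_FLNorm_duhamel_sub hum hs
        (lintegral_FLNorm_convPow_ne_top m (fun t _ => hu.of_uncurry_left) hB huB))
    rw [add_zero] at hlim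
    have hev := hlim.eventually_lt_const (ENNReal.ofReal_pos.2 hε)
    obtain ⟨δ, hδ, hball⟩ := Metric.mem_nhdsWithin_iff.1 hev
    refine ⟨δ, hδ, fun t ht hts => ?_⟩
    refine lt_of_le_of_lt ?_ (hball ⟨(by simpa [Real.dist_eq] using hts), ht⟩)
    have e : (fun ξ => u t ξ - u s ξ) =ᵐ[volume] fun ξ =>
        (Vflow d F₀ F₁ t ξ - Vflow d F₀ F₁ s ξ)
          + -(duhamel d (convPow d (m + 1) u) t ξ - duhamel d (convPow d (m + 1) u) s ξ) := by
      filter_upwards [hae t ht, hae s hs] with ξ e₁ e₂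
      rw [e₁, e₂]
      ring
    rw [FLNorm_congr_ae e]
    refine (FLNorm_add_le ((hVm t).sub (hVm s))).trans (le_of_eq ?_)
    simp only [FLNorm_eq_lintegral_enorm, enorm_neg]
    rfl
  duhamel t ht := by
    filter_upwards [hae t ht] with ξ hξ
    rw [hξ, Nat.add_sub_cancel]
    simp only [convIter_eq_listConv]
    rfl

/-! ### Measurable modifications and uniqueness -/

lemma IsDuhamelSolution.tendsto {d k : ℕ} {T : ℝ} {F₀ F₁ : Edim d → ℂ} {v : ℝ → Edim d → ℂ}
    (hv : IsDuhamelSolution d k T F₀ F₁ v) {s : ℝ} (hs : s ∈ Set.Icc 0 T) :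
    Tendsto (fun t => FLNorm d (fun ξ => v t ξ - v s ξ)) (𝓝[Set.Icc 0 T] s) (𝓝 0) := by
  refine ENNReal.tendsto_nhds_zero.2 fun ε hε => ?_
  obtain ⟨e, he, heε⟩ := ENNReal.lt_iff_exists_real_btwn.1 hε
  have he0 : 0 < e := ENNReal.ofReal_pos.1 heε.1
  obtain ⟨δ, hδ, h⟩ := hv.continuous s hs e he0
  refine Metric.mem_nhdsWithin_iff.2 ⟨δ, hδ, fun t ht => ?_⟩
  exact (h t ht.2 (by simpa [Real.dist_eq] using ht.1)).le.trans heε.2.le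

lemma integrable_solution {d k : ℕ} {T : ℝ} {F₀ F₁ : Edim d → ℂ} {v : ℝ → Edim d → ℂ}
    (hv : IsDuhamelSolution d k T F₀ F₁ v) {s : ℝ} (hs : s ∈ Set.Icc 0 T) :
    Integrable (v s) volume :=
  integrable_of_FLNorm_lt_top (hv.measurable s hs) (hv.finite s hs)

/-- A Duhamel solution as a curve in `L¹` on the Fourier side. -/
def IsDuhamelSolution.toL1 {d k : ℕ} {T : ℝ} {F₀ F₁ : Edim d → ℂ} {v : ℝ → Edim d → ℂ}
    (hv : IsDuhamelSolution d k T F₀ F₁ v) (t : Set.Icc (0 : ℝ) T) : FreqL1 d :=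
  (integrable_solution hv t.2).toL1 (v t)

lemma IsDuhamelSolution.edist_toL1 {d k : ℕ} {T : ℝ} {F₀ F₁ : Edim d → ℂ}
    {v : ℝ → Edim d → ℂ} (hv : IsDuhamelSolution d k T F₀ F₁ v) (t s : Set.Icc (0 : ℝ) T) :
    edist (hv.toL1 t) (hv.toL1 s) = FLNorm d (fun ξ => v t ξ - v s ξ) := by
  rw [FLNorm_sub_eq_ofReal_norm (integrable_solution hv t.2) (integrable_solution hv s.2),
    edist_eq_enorm_sub, ofReal_norm]
  rfl

lemma IsDuhamelSolution.continuous_toL1 {d k : ℕ} {T : ℝ} {F₀ F₁ : Edim d → ℂ}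
    {v : ℝ → Edim d → ℂ} (hv : IsDuhamelSolution d k T F₀ F₁ v) : Continuous hv.toL1 := by
  refine continuous_iff_continuousAt.2 fun s => ?_
  rw [ContinuousAt, tendsto_iff_edist_tendsto_0]
  simp only [hv.edist_toL1]
  have h := hv.tendsto s.2
  rw [nhdsWithin_eq_map_subtype_coe s.2, tendsto_map'_iff] at h
  exact h

lemma IsDuhamelSolution.exists_bound {d k : ℕ} {T : ℝ} {F₀ F₁ : Edim d → ℂ}
    {v : ℝ → Edim d → ℂ} (hv : IsDuhamelSolution d k T F₀ F₁ v) :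
    ∃ B : ℝ, 0 ≤ B ∧ ∀ t ∈ Set.Icc 0 T, FLNorm d (v t) ≤ ENNReal.ofReal B := by
  obtain ⟨B, hB⟩ := (isCompact_range hv.continuous_toL1).isBounded.exists_norm_le
  refine ⟨max B 0, le_max_right _ _, fun t ht => ?_⟩
  have h := hB _ ⟨⟨t, ht⟩, rfl⟩
  have e : FLNorm d (v t) = ENNReal.ofReal ‖hv.toL1 ⟨t, ht⟩‖ := by
    rw [ofReal_norm, IsDuhamelSolution.toL1, Integrable.enorm_toL1]
    rfl
  rw [e]
  exact ENNReal.ofReal_le_ofReal (h.trans (le_max_left _ _))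

/-- The grid point of mesh `δ` to the left of `t`. -/
def gridFloor (δ t : ℝ) : ℝ := ⌊t / δ⌋ * δ

lemma gridFloor_mem {δ T t : ℝ} (hδ : 0 < δ) (ht : t ∈ Set.Icc 0 T) :
    gridFloor δ t ∈ Set.Icc 0 T := by
  have h0 : (0 : ℝ) ≤ ⌊t / δ⌋ := by exact_mod_cast Int.floor_nonneg.2 (div_nonneg ht.1 hδ.le)
  refine ⟨mul_nonneg h0 hδ.le, le_trans ?_ ht.2⟩
  exact (le_div_iff₀ hδ).1 (Int.floor_le (t / δ))

lemma abs_sub_gridFloor_lt {δ t : ℝ} (hδ : 0 < δ) : |t - gridFloor δ t| < δ := by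
  have h₁ : gridFloor δ t ≤ t := (le_div_iff₀ hδ).1 (Int.floor_le (t / δ))
  have h₂ : t < (⌊t / δ⌋ + 1) * δ := (div_lt_iff₀ hδ).1 (Int.lt_floor_add_one (t / δ))
  rw [abs_of_nonneg (sub_nonneg.2 h₁)]
  rw [gridFloor]
  linarith

lemma ae_tendsto_of_tsum_FLNorm_sub_lt_top {d : ℕ} {f : ℕ → Edim d → ℂ} {F : Edim d → ℂ}
    (hf : ∀ n, Measurable (f n)) (hF : Measurable F)
    (h : ∑' n, FLNorm d (fun ξ => f n ξ - F ξ) ≠ ⊤) :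
    ∀ᵐ ξ : Edim d, Tendsto (fun n => f n ξ) atTop (𝓝 (F ξ)) := by
  have hm : ∀ n, Measurable fun ξ => ‖f n ξ - F ξ‖ₑ := fun n => ((hf n).sub hF).enorm
  simp only [FLNorm_eq_lintegral_enorm] at h
  rw [← lintegral_tsum fun n => (hm n).aemeasurable] at h
  have h' := ae_lt_top' (Measurable.tsum hm).aemeasurable h
  filter_upwards [h'] with ξ hξ
  rw [tendsto_iff_edist_tendsto_0]
  simp only [edist_eq_enorm_sub]
  exact ENNReal.tendsto_atTop_zero_of_tsum_ne_top hξ.ne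

lemma IsDuhamelSolution.exists_measurable_modification {d k : ℕ} {T : ℝ} {F₀ F₁ : Edim d → ℂ}
    {v : ℝ → Edim d → ℂ} (hv : IsDuhamelSolution d k T F₀ F₁ v) :
    ∃ w : ℝ → Edim d → ℂ, Measurable (Function.uncurry w) ∧
      ∀ t ∈ Set.Icc 0 T, w t =ᵐ[volume] v t := by
  have huc : UniformContinuous hv.toL1 :=
    CompactSpace.uniformContinuous_of_continuous hv.continuous_toL1
  have hε : ∀ n : ℕ, (0 : ℝ≥0∞) < 2⁻¹ ^ n := fun n => ENNReal.pow_pos (by simp) n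
  have hδ : ∀ n : ℕ, ∃ δ : ℝ, 0 < δ ∧ ∀ t ∈ Set.Icc 0 T, ∀ s ∈ Set.Icc 0 T, |t - s| < δ →
      FLNorm d (fun ξ => v t ξ - v s ξ) ≤ 2⁻¹ ^ n := by
    intro n
    obtain ⟨δ, hδ, h⟩ := EMetric.uniformContinuous_iff.1 huc _ (hε n)
    obtain ⟨e, he, heδ⟩ := ENNReal.lt_iff_exists_real_btwn.1 hδ
    refine ⟨e, ENNReal.ofReal_pos.1 heδ.1, fun t ht s hs hts => ?_⟩
    rw [← hv.edist_toL1 ⟨t, ht⟩ ⟨s, hs⟩]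
    refine (h (lt_of_le_of_lt ?_ heδ.2)).le
    rw [Subtype.edist_eq, edist_dist, Real.dist_eq]
    exact ENNReal.ofReal_le_ofReal hts.le
  choose δ hδ0 hδ using hδ
  classical
  let w : ℕ → ℝ → Edim d → ℂ := fun n t ξ =>
    if gridFloor (δ n) t ∈ Set.Icc 0 T then v (gridFloor (δ n) t) ξ else 0
  have hwm : ∀ n, Measurable (Function.uncurry (w n)) := by
    intro n
    have hz : Measurable fun p : ℤ × Edim d =>
        if (p.1 : ℝ) * δ n ∈ Set.Icc 0 T then v (p.1 * δ n) p.2 else 0 := by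
      refine measurable_from_prod_countable_right fun z => ?_
      by_cases hz : (z : ℝ) * δ n ∈ Set.Icc 0 T
      · simpa only [hz, if_true] using hv.measurable _ hz
      · simpa only [hz, if_false] using measurable_const
    exact hz.comp (((Int.measurable_floor.comp
      (measurable_fst.div_const (δ n)))).prodMk measurable_snd)
  have hlim : Measurable fun p : ℝ × Edim d =>
      limUnder atTop fun n => Function.uncurry (w n) p :=
    (StronglyMeasurable.limUnder fun n => (hwm n).stronglyMeasurable).measurable
  refine ⟨fun t ξ => limUnder atTop fun n => w n t ξ, hlim, fun t ht => ?_⟩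
  have hwt : ∀ n, FLNorm d (fun ξ => w n t ξ - v t ξ) ≤ 2⁻¹ ^ n := by
    intro n
    have hg := gridFloor_mem (hδ0 n) ht
    simp only [w, if_pos hg]
    rw [FLNorm_sub_comm]
    exact hδ n t ht _ hg (abs_sub_gridFloor_lt (hδ0 n))
  have hsum : ∑' n, FLNorm d (fun ξ => w n t ξ - v t ξ) ≠ ⊤ := by
    refine ((ENNReal.tsum_le_tsum hwt).trans_lt ?_).ne
    rw [ENNReal.tsum_geometric, ENNReal.one_sub_inv_two, inv_inv]
    exact ENNReal.ofNat_lt_top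
  filter_upwards [ae_tendsto_of_tsum_FLNorm_sub_lt_top
    (fun n => (hwm n).of_uncurry_left) (hv.measurable t ht) hsum] with ξ hξ
  exact hξ.limUnder_eq

lemma FLNorm_convPow_sub_le {d : ℕ} (m : ℕ) {u v : ℝ → Edim d → ℂ} {t B : ℝ}
    (hu : Measurable (u t)) (hv : Measurable (v t)) (hB : 0 ≤ B)
    (huB : FLNorm d (u t) ≤ ENNReal.ofReal B) (hvB : FLNorm d (v t) ≤ ENNReal.ofReal B) :
    FLNorm d (fun ξ => convPow d (m + 1) u t ξ - convPow d (m + 1) v t ξ)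
      ≤ ENNReal.ofReal ((m + 1) * B ^ m) * FLNorm d (fun ξ => u t ξ - v t ξ) := by
  have hui : Integrable (u t) volume :=
    integrable_of_FLNorm_lt_top hu (huB.trans_lt ENNReal.ofReal_lt_top)
  have hvi : Integrable (v t) volume :=
    integrable_of_FLNorm_lt_top hv (hvB.trans_lt ENNReal.ofReal_lt_top)
  let U : FreqL1 d := hui.toL1 (u t)
  let V : FreqL1 d := hvi.toL1 (v t)
  have hU : ‖U‖ ≤ B := by
    rw [← ENNReal.ofReal_le_ofReal_iff hB, ofReal_norm, Integrable.enorm_toL1]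
    exact huB
  have hV : ‖V‖ ≤ B := by
    rw [← ENNReal.ofReal_le_ofReal_iff hB, ofReal_norm, Integrable.enorm_toL1]
    exact hvB
  have hcu : Integrable (convPow d (m + 1) u t) volume :=
    integrable_listConv (f := fun _ : Fin (m + 1) => u t) fun _ => hui
  have hcv : Integrable (convPow d (m + 1) v t) volume :=
    integrable_listConv (f := fun _ : Fin (m + 1) => v t) fun _ => hvi
  have eu : hcu.toL1 _ = convMultilinear d m fun _ => U :=
    (convMultilinear_toL1 (f := fun _ => u t) fun _ => hui).symm
  have ev : hcv.toL1 _ = convMultilinear d m fun _ => V :=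
    (convMultilinear_toL1 (f := fun _ => v t) fun _ => hvi).symm
  rw [FLNorm_sub_eq_ofReal_norm hcu hcv, FLNorm_sub_eq_ofReal_norm hui hvi, eu, ev,
    ← ENNReal.ofReal_mul (by positivity)]
  refine ENNReal.ofReal_le_ofReal
    (((convMultilinear d m).norm_image_sub_le (fun _ => U) fun _ => V).trans ?_)
  have hmax : max ‖fun _ : Fin (m + 1) => U‖ ‖fun _ : Fin (m + 1) => V‖ ≤ B :=
    max_le ((pi_norm_const_le _).trans hU) ((pi_norm_const_le _).trans hV)
  have hdiff : ‖(fun _ : Fin (m + 1) => U) - fun _ : Fin (m + 1) => V‖ ≤ ‖U - V‖ :=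
    pi_norm_const_le (U - V)
  have hL := norm_convMultilinear_le d m
  rw [Fintype.card_fin, Nat.add_sub_cancel]
  calc _ ≤ 1 * ((m + 1 : ℕ) : ℝ) * B ^ m * ‖U - V‖ := by gcongr
    _ = _ := by push_cast; ring

lemma setLIntegral_ofReal_pow {t : ℝ} (ht : 0 ≤ t) (n : ℕ) :
    ∫⁻ s in Set.Ioc 0 t, ENNReal.ofReal (s ^ n) = ENNReal.ofReal (t ^ (n + 1) / (n + 1)) := by
  have hi : IntegrableOn (fun s : ℝ => s ^ n) (Set.Ioc 0 t) volume :=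
    (intervalIntegrable_iff_integrableOn_Ioc_of_le ht).1 (intervalIntegral.intervalIntegrable_pow n)
  rw [← ofReal_integral_eq_lintegral_ofReal hi
    ((ae_restrict_mem measurableSet_Ioc).mono fun s hs => pow_nonneg hs.1.le n),
    ← intervalIntegral.integral_of_le ht, integral_pow]
  simp

lemma eq_zero_of_le_lintegral {D : ℝ → ℝ≥0∞} {T B K : ℝ} (hB : 0 ≤ B) (hK : 0 ≤ K)
    (hDB : ∀ t ∈ Set.Icc 0 T, D t ≤ ENNReal.ofReal B)
    (hD : ∀ t ∈ Set.Icc 0 T, D t ≤ ENNReal.ofReal K * ∫⁻ s in Set.Ioc 0 t, D s) :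
    ∀ t ∈ Set.Icc 0 T, D t = 0 := by
  have key : ∀ n : ℕ, ∀ t ∈ Set.Icc 0 T,
      D t ≤ ENNReal.ofReal (B * K ^ n / n.factorial) * ENNReal.ofReal (t ^ n) := by
    intro n
    induction n with
    | zero => simpa using hDB
    | succ n ih =>
      intro t ht
      refine (hD t ht).trans ?_
      have hle : ∫⁻ s in Set.Ioc 0 t, D s ≤ ENNReal.ofReal (B * K ^ n / n.factorial)
          * ENNReal.ofReal (t ^ (n + 1) / (n + 1)) := by
        rw [← setLIntegral_ofReal_pow ht.1, ← lintegral_const_mul' _ _ ENNReal.ofReal_ne_top]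
        exact setLIntegral_mono' measurableSet_Ioc fun s hs => ih s ⟨hs.1.le, hs.2.trans ht.2⟩
      refine (mul_le_mul_right hle _).trans (le_of_eq ?_)
      rw [← ENNReal.ofReal_mul (by positivity), ← ENNReal.ofReal_mul hK,
        ← ENNReal.ofReal_mul (by positivity)]
      congr 1
      rw [Nat.factorial_succ]
      push_cast
      field_simp
      ring
  intro t ht
  have hlim := (FloorSemiring.tendsto_pow_div_factorial_atTop (K * t)).const_mul B
  rw [mul_zero] at hlim
  have hlim' := ENNReal.tendsto_ofReal hlim
  rw [ENNReal.ofReal_zero] at hlim'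
  refine le_antisymm (ge_of_tendsto' hlim' fun n => (key n t ht).trans (le_of_eq ?_)) zero_le
  rw [← ENNReal.ofReal_mul (by positivity), mul_pow]
  congr 1
  ring

lemma isDuhamelSolution_ae_eq_duhamel {d m : ℕ} {T : ℝ} {F₀ F₁ : Edim d → ℂ}
    {v w : ℝ → Edim d → ℂ} (hv : IsDuhamelSolution d (m + 2) T F₀ F₁ v)
    (hw : ∀ t ∈ Set.Icc 0 T, w t =ᵐ[volume] v t) {t : ℝ} (ht : t ∈ Set.Icc 0 T) :
    v t =ᵐ[volume] fun ξ => Vflow d F₀ F₁ t ξ - duhamel d (convPow d (m + 2) w) t ξ := by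
  filter_upwards [hv.duhamel t ht] with ξ hξ
  rw [hξ, Vflow, duhamel]
  congr 1
  refine intervalIntegral.integral_congr fun t' ht' => ?_
  rw [Set.uIcc_of_le ht.1] at ht'
  have h := convIter_congr_ae (hw t' ⟨ht'.1, ht'.2.trans ht.2⟩) m
  have hk : m + 2 - 1 = m + 1 := rfl
  simp only [hk, ← h, convIter_eq_listConv]
  rfl

lemma isDuhamelSolution_ae_eq {d m : ℕ} {T : ℝ} {F₀ F₁ : Edim d → ℂ}
    {u v : ℝ → Edim d → ℂ} (hu : IsDuhamelSolution d (m + 2) T F₀ F₁ u)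
    (hv : IsDuhamelSolution d (m + 2) T F₀ F₁ v) :
    ∀ t ∈ Set.Icc 0 T, v t =ᵐ[volume] u t := by
  obtain ⟨u', hum, hu'⟩ := hu.exists_measurable_modification
  obtain ⟨v', hvm, hv'⟩ := hv.exists_measurable_modification
  obtain ⟨Bu, hBu0, hBu⟩ := hu.exists_bound
  obtain ⟨Bv, hBv0, hBv⟩ := hv.exists_bound
  let B := max Bu Bv
  have hB0 : 0 ≤ B := le_max_of_le_left hBu0
  have hBu' : ∀ t ∈ Set.Icc 0 T, FLNorm d (u' t) ≤ ENNReal.ofReal B := fun t ht => by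
    rw [FLNorm_congr_ae (hu' t ht)]
    exact (hBu t ht).trans (ENNReal.ofReal_le_ofReal (le_max_left _ _))
  have hBv' : ∀ t ∈ Set.Icc 0 T, FLNorm d (v' t) ≤ ENNReal.ofReal B := fun t ht => by
    rw [FLNorm_congr_ae (hv' t ht)]
    exact (hBv t ht).trans (ENNReal.ofReal_le_ofReal (le_max_right _ _))
  have hcum := measurable_convPow_uncurry (m + 1) hum
  have hcvm := measurable_convPow_uncurry (m + 1) hvm
  let K := T * (((m + 1 : ℕ) + 1) * B ^ (m + 1))
  let D : ℝ → ℝ≥0∞ := fun t => FLNorm d (fun ξ => v' t ξ - u' t ξ)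
  have hsub : ∀ {t : ℝ}, t ∈ Set.Icc 0 T → Set.Icc 0 t ⊆ Set.Icc 0 T := fun ht =>
    Set.Icc_subset_Icc_right ht.2
  have hD : ∀ t ∈ Set.Icc 0 T, D t ≤ ENNReal.ofReal K * ∫⁻ s in Set.Ioc 0 t, D s := by
    intro t ht
    have htt : t ∈ Set.Icc 0 t := ⟨ht.1, le_rfl⟩
    have hufin := lintegral_FLNorm_convPow_ne_top (T := t) (m + 1)
      (fun s _ => hum.of_uncurry_left) ENNReal.ofReal_ne_top fun s hs => hBu' s (hsub ht hs)
    have hvfin := lintegral_FLNorm_convPow_ne_top (T := t) (m + 1)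
      (fun s _ => hvm.of_uncurry_left) ENNReal.ofReal_ne_top fun s hs => hBv' s (hsub ht hs)
    have e : (fun ξ => v' t ξ - u' t ξ) =ᵐ[volume] duhamel d (fun s ξ =>
        convPow d (m + 2) u' s ξ - convPow d (m + 2) v' s ξ) t := by
      filter_upwards [hu' t ht, hv' t ht, isDuhamelSolution_ae_eq_duhamel hu hu' ht,
        isDuhamelSolution_ae_eq_duhamel hv hv' ht,
        duhamel_sub_ae hcum hcvm htt hufin hvfin] with ξ e₁ e₂ e₃ e₄ e₅
      rw [e₁, e₂, e₃, e₄, ← e₅]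
      ring
    refine (FLNorm_congr_ae e).le.trans
      ((FLNorm_duhamel_le (hcum.sub hcvm) htt).trans ?_)
    have hle_int : ∫⁻ s in Set.Ioc 0 t, FLNorm d (fun ξ =>
        convPow d (m + 2) u' s ξ - convPow d (m + 2) v' s ξ)
        ≤ ENNReal.ofReal (((m + 1 : ℕ) + 1) * B ^ (m + 1)) * ∫⁻ s in Set.Ioc 0 t, D s := by
      rw [← lintegral_const_mul' _ _ ENNReal.ofReal_ne_top]
      refine setLIntegral_mono' measurableSet_Ioc fun s hs => ?_
      have hs' := hsub ht (Set.Ioc_subset_Icc_self hs)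
      refine (FLNorm_convPow_sub_le (m + 1) hum.of_uncurry_left hvm.of_uncurry_left hB0
        (hBu' s hs') (hBv' s hs')).trans (le_of_eq ?_)
      rw [FLNorm_sub_comm]
    rw [ENNReal.ofReal_mul (ht.1.trans ht.2), mul_assoc]
    exact mul_le_mul' (ENNReal.ofReal_le_ofReal ht.2) hle_int
  have hDB : ∀ t ∈ Set.Icc 0 T, D t ≤ ENNReal.ofReal (B + B) := by
    intro t ht
    rw [ENNReal.ofReal_add hB0 hB0]
    have h := FLNorm_sub_le (F := v' t) (G := fun _ => 0) (H := u' t) hvm.of_uncurry_left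
      measurable_const
    rw [FLNorm_sub_comm (fun _ => 0) (u' t)] at h
    simp only [sub_zero] at h
    exact h.trans (add_le_add (hBv' t ht) (hBu' t ht))
  intro t ht
  have hK : 0 ≤ K := mul_nonneg (ht.1.trans ht.2) (by positivity)
  have h0 := eq_zero_of_le_lintegral (add_nonneg hB0 hB0) hK hDB hD t ht
  exact (hv' t ht).symm.trans
    ((ae_eq_of_FLNorm_sub_eq_zero hvm.of_uncurry_left hum.of_uncurry_left h0).trans (hu' t ht))

lemma smallness_condition {k : ℕ} {M T : ℝ} (hM : 0 < M) (hT : 0 < T)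
    (hle : T ≤ (6 ^ k)⁻¹ * min (M ^ (-((k : ℝ) - 1) / 2)) 1) :
    T ≤ 1 ∧ 3 * M + T ^ 2 * (6 * M) ^ k ≤ 6 * M := by
  have hc : ((6 : ℝ) ^ k)⁻¹ ≤ 1 := inv_le_one_of_one_le₀ (one_le_pow₀ (by norm_num))
  have hc0 : (0 : ℝ) < (6 ^ k)⁻¹ := by positivity
  have hp : (0 : ℝ) < M ^ (-((k : ℝ) - 1) / 2) := rpow_pos_of_pos hM _
  refine ⟨hle.trans (mul_le_one₀ hc (le_min hp.le zero_le_one) (min_le_right _ _)), ?_⟩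
  have hT' : T ≤ (6 ^ k)⁻¹ * M ^ (-((k : ℝ) - 1) / 2) :=
    hle.trans (mul_le_mul_of_nonneg_left (min_le_left _ _) hc0.le)
  have hsq : (M ^ (-((k : ℝ) - 1) / 2)) ^ 2 * M ^ k = M := by
    rw [← rpow_natCast, ← rpow_natCast, ← rpow_mul hM.le, ← rpow_add hM]
    convert rpow_one M using 2
    push_cast
    ring
  have hT2 : T ^ 2 ≤ ((6 ^ k)⁻¹ * M ^ (-((k : ℝ) - 1) / 2)) ^ 2 := by gcongr
  have h6 : ((6 : ℝ) ^ k)⁻¹ * 6 ^ k = 1 := inv_mul_cancel₀ (by positivity)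
  calc 3 * M + T ^ 2 * (6 * M) ^ k
      ≤ 3 * M + ((6 ^ k)⁻¹ * M ^ (-((k : ℝ) - 1) / 2)) ^ 2 * (6 * M) ^ k := by gcongr
    _ = 3 * M + (6 ^ k)⁻¹ * ((6 ^ k)⁻¹ * 6 ^ k)
          * ((M ^ (-((k : ℝ) - 1) / 2)) ^ 2 * M ^ k) := by ring
    _ = 3 * M + (6 ^ k)⁻¹ * M := by rw [h6, hsq, mul_one]
    _ ≤ 6 * M := by nlinarith

/-- Lemma 2.4: local well-posedness of vNLW in the Wiener algebra
`FL^{0,1}(ℝ^d)` for `0 < T ≤ c·min(M^{-(k-1)/2},1)`, together with the power series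
expansion `u = Σ_j Ξ_j(u⃗₀)` converging in `C([0,T]; FL^{0,1})`. -/
theorem vNLW_wellposedness_Wiener_and_power_series
    (d k : ℕ) (hd : 1 ≤ d) (hk : 2 ≤ k) :
    ∃ c : ℝ, 0 < c ∧ ∀ M : ℝ, 0 < M → ∀ T : ℝ,
      0 < T → T ≤ c * min (M ^ (-((k : ℝ) - 1) / 2)) 1 →
      ∀ F₀ F₁ : Edim d → ℂ, MemFLPair d F₀ F₁ →
        pairFLNorm d F₀ F₁ ≤ ENNReal.ofReal M →
        ∃ u : ℝ → Edim d → ℂ, IsDuhamelSolution d k T F₀ F₁ u ∧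
          (∀ v : ℝ → Edim d → ℂ, IsDuhamelSolution d k T F₀ F₁ v →
            ∀ t ∈ Set.Icc (0 : ℝ) T, v t =ᵐ[volume] u t) ∧
          Filter.Tendsto (fun n : ℕ => ⨆ t ∈ Set.Icc (0 : ℝ) T,
              FLNorm d (fun ξ => (∑ j ∈ Finset.range n, Xi d k F₀ F₁ j t ξ) - u t ξ))
            Filter.atTop (𝓝 0) := by
  refine ⟨(6 ^ k)⁻¹, by positivity, fun M hM T hT hTle F₀ F₁ hF hFM => ?_⟩
  obtain ⟨m, rfl⟩ := Nat.exists_eq_add_of_le' hk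
  have hsmall := smallness_condition hM hT hTle
  have hA : 3 * pairFLNorm d F₀ F₁ ≤ ENNReal.ofReal (3 * M) := by
    rw [ENNReal.ofReal_mul (by norm_num), ENNReal.ofReal_ofNat]
    exact mul_le_mul_right hFM _
  have hAB : ENNReal.ofReal (3 * M)
      + ENNReal.ofReal (T ^ 2) * ENNReal.ofReal (6 * M) ^ (m + 1 + 1)
      ≤ ENNReal.ofReal (6 * M) := by
    rw [← ENNReal.ofReal_pow (by positivity), ← ENNReal.ofReal_mul (by positivity),
      ← ENNReal.ofReal_add (by positivity) (by positivity)]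
    exact ENNReal.ofReal_le_ofReal hsmall.2
  have hfin : ∑' j, XiSup d (m + 1 + 1) F₀ F₁ T j ≠ ⊤ :=
    ((tsum_XiSup_le hF.1 hF.2.1 hsmall.1 hA hAB).trans_lt ENNReal.ofReal_lt_top).ne
  have hsol : IsDuhamelSolution d (m + 2) T F₀ F₁ (XiLim d (m + 2) F₀ F₁) :=
    isDuhamelSolution_of_ae_eq hF hsmall.1 (measurable_XiLim_uncurry (m + 1) hF.1 hF.2.1) hfin
      (fun t ht => FLNorm_XiLim_le hF.1 hF.2.1 hfin ht)
      fun t ht => XiLim_ae_eq hF.1 hF.2.1 hfin ht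
  exact ⟨XiLim d (m + 2) F₀ F₁, hsol, fun v hv => isDuhamelSolution_ae_eq hsol hv,
    tendsto_iSup_FLNorm_sum_Xi_sub_XiLim hF.1 hF.2.1 hfin⟩

end
end

section
/- Let d ≥ 1, let k ≥ 2 be an integer, and let s < 0. There exist constants c, δ > 0, depending only on d, k, s, such that for all A ≥ 1, all N ≥ A/δ, all R > 0, all t with 0 < t ≤ δ/N, and φ the function with φ̂ = R·𝟙_Ω, setting φ⃗ := (φ,0), one has ‖Ξ₁(φ⃗)(t)‖_{H^s(ℝ^d)} ≥ c R^k t² A^{d(k−1)} g_s(A). -/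
open MeasureTheory Real Set Filter Topology
open scoped ENNReal NNReal BigOperators

noncomputable section

/-- The closed axis-parallel cube of half-side `r` centred at `a`. -/
def coordBox (d : ℕ) (a : Edim d) (r : ℝ) : Set (Edim d) := {ξ | ∀ i, |ξ i - a i| ≤ r}

lemma coordBox_eq_preimage (d : ℕ) (a : Edim d) {r : ℝ} (hr : 0 ≤ r) :
    coordBox d a r = WithLp.ofLp ⁻¹' Metric.closedBall (WithLp.ofLp a) r := by
  ext ξ
  simp [coordBox, dist_pi_le_iff hr, Real.dist_eq]

lemma measurableSet_coordBox (d : ℕ) (a : Edim d) (r : ℝ) : MeasurableSet (coordBox d a r) := by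
  unfold coordBox
  simp only [Set.ofPred_forall]
  refine MeasurableSet.iInter fun i => measurableSet_le ?_ measurable_const
  fun_prop

lemma volume_coordBox (d : ℕ) (a : Edim d) {r : ℝ} (hr : 0 ≤ r) :
    volume (coordBox d a r) = ENNReal.ofReal ((2 * r) ^ d) := by
  rw [coordBox_eq_preimage d a hr,
    (PiLp.volume_preserving_ofLp (Fin d)).measure_preimage
      Metric.isClosed_closedBall.measurableSet.nullMeasurableSet,
    Real.volume_pi_closedBall _ hr, Fintype.card_fin]

lemma coordBox_zero_mono (d : ℕ) {r r' : ℝ} (h : r ≤ r') : coordBox d 0 r ⊆ coordBox d 0 r' :=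
  fun _ hξ i => (hξ i).trans h

lemma cubeSet_eq_coordBox (d : ℕ) (A : ℝ) : cubeSet d A = coordBox d 0 (A / 8) := by
  ext ξ
  simp [cubeSet, coordBox]

lemma norm_le_of_abs_coord_le {d : ℕ} {ξ : Edim d} {r : ℝ} (hr : 0 ≤ r)
    (h : ∀ i, |ξ i| ≤ r) : ‖ξ‖ ≤ d * r := by
  rw [EuclideanSpace.norm_eq]
  refine Real.sqrt_le_iff.mpr ⟨by positivity, ?_⟩
  have hsum : ∑ i, ‖ξ i‖ ^ 2 ≤ ∑ _i : Fin d, r ^ 2 :=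
    Finset.sum_le_sum fun i _ => pow_le_pow_left₀ (norm_nonneg _) (h i) 2
  refine hsum.trans ?_
  rw [Finset.sum_const, Finset.card_univ, Fintype.card_fin, nsmul_eq_mul, mul_pow]
  have hd : (d : ℝ) ≤ (d : ℝ) ^ 2 := by exact_mod_cast Nat.le_self_pow two_ne_zero d
  gcongr

lemma ofReal_weight_mul_volume_le {d : ℕ} {s B : ℝ} (hs : s ≤ 0) (hB : 1 ≤ B)
    {S : Set (Edim d)} (hS : MeasurableSet S) (hSB : S ⊆ coordBox d 0 B) :
    ENNReal.ofReal (((1 + (d : ℝ) ^ 2) * B ^ 2) ^ s) * volume S ≤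
      ∫⁻ ξ in S, ENNReal.ofReal ((1 + ‖ξ‖ ^ 2) ^ s) := by
  rw [← setLIntegral_const]
  refine setLIntegral_mono' hS fun ξ hξ => ENNReal.ofReal_le_ofReal ?_
  refine Real.rpow_le_rpow_of_nonpos (by positivity) ?_ hs
  have hn : ‖ξ‖ ≤ d * B :=
    norm_le_of_abs_coord_le (by linarith) fun i => by simpa using hSB hξ i
  have h1 : ‖ξ‖ ^ 2 ≤ (d * B) ^ 2 := pow_le_pow_left₀ (norm_nonneg _) hn 2
  nlinarith

/-- At the critical exponent, each dyadic shell contributes a fixed amount. -/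
lemma weight_critical_dyadic {d : ℕ} (hd : 1 ≤ d) :
    ∃ c : ℝ, 0 < c ∧ ∀ n : ℕ, ENNReal.ofReal (c * (n + 1)) ≤
      ∫⁻ ξ in cubeSet d (2 ^ n), ENNReal.ofReal ((1 + ‖ξ‖ ^ 2) ^ (-(d : ℝ) / 2)) := by
  set K : ℝ := (1 + (d : ℝ) ^ 2) ^ (-(d : ℝ) / 2) with hK
  have hKpos : 0 < K := by positivity
  have hs : -(d : ℝ) / 2 ≤ 0 := by
    have : (0 : ℝ) ≤ d := by positivity
    linarith
  have hweight : ∀ B : ℝ, 0 < B →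
      ((1 + (d : ℝ) ^ 2) * B ^ 2) ^ (-(d : ℝ) / 2) = K * (B ^ d)⁻¹ := by
    intro B hB
    rw [Real.mul_rpow (by positivity) (by positivity), ← hK, ← Real.rpow_natCast B 2,
      ← Real.rpow_mul hB.le, ← Real.rpow_natCast B d, ← Real.rpow_neg hB.le]
    congr 2
    push_cast
    ring
  refine ⟨K * (1 / 8) ^ d, by positivity, fun n => ?_⟩
  induction n with
  | zero =>
    have h := ofReal_weight_mul_volume_le (d := d) (s := -(d : ℝ) / 2) hs le_rfl
      (measurableSet_coordBox d 0 (1 / 8)) (coordBox_zero_mono d (by norm_num))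
    rw [volume_coordBox d 0 (by norm_num), ← ENNReal.ofReal_mul (by positivity),
      hweight 1 one_pos] at h
    rw [pow_zero, cubeSet_eq_coordBox]
    refine le_trans (ENNReal.ofReal_le_ofReal ?_) h
    simp only [one_pow, inv_one, mul_one, Nat.cast_zero, zero_add]
    gcongr
    norm_num
  | succ n ih =>
    set b : ℝ := 2 ^ n / 8 with hb
    have hbpos : 0 < b := by positivity
    have hsub : cubeSet d (2 ^ n) ⊆ cubeSet d (2 ^ (n + 1)) := by
      rw [cubeSet_eq_coordBox, cubeSet_eq_coordBox]
      exact coordBox_zero_mono d (by rw [pow_succ]; linarith)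
    have hmeas : ∀ A, MeasurableSet (cubeSet d A) := fun A => by
      rw [cubeSet_eq_coordBox]; exact measurableSet_coordBox _ _ _
    have hvol : ENNReal.ofReal ((2 * b) ^ d) ≤
        volume (cubeSet d (2 ^ (n + 1)) \ cubeSet d (2 ^ n)) := by
      rw [measure_sdiff hsub (hmeas _).nullMeasurableSet, cubeSet_eq_coordBox, cubeSet_eq_coordBox,
        volume_coordBox _ _ (by positivity), volume_coordBox _ _ (by positivity),
        ← ENNReal.ofReal_sub _ (by positivity)]
      · refine ENNReal.ofReal_le_ofReal ?_
        have h2 : (2 : ℝ) * (2 ^ (n + 1) / 8) = 2 * (2 * b) := by rw [hb, pow_succ]; ring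
        rw [h2, ← hb, mul_pow 2 (2 * b) d]
        have h3 : (2 : ℝ) ≤ 2 ^ d := by simpa using pow_le_pow_right₀ (one_le_two (α := ℝ)) hd
        nlinarith [show (0 : ℝ) < (2 * b) ^ d by positivity]
      · rw [cubeSet_eq_coordBox, volume_coordBox _ _ (by positivity)]
        exact ENNReal.ofReal_ne_top
    have hshell := ofReal_weight_mul_volume_le (d := d) (s := -(d : ℝ) / 2) (B := 2 ^ (n + 1)) hs
      (one_le_pow₀ one_le_two) ((hmeas (2 ^ (n + 1))).diff (hmeas (2 ^ n))) (by
        refine Set.sdiff_subset.trans ?_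
        rw [cubeSet_eq_coordBox]
        exact coordBox_zero_mono d (by linarith [show (0 : ℝ) < 2 ^ (n + 1) by positivity]))
    rw [hweight _ (by positivity)] at hshell
    calc ENNReal.ofReal (K * (1 / 8) ^ d * ((n + 1 : ℕ) + 1))
        = ENNReal.ofReal (K * (1 / 8) ^ d * (n + 1)) + ENNReal.ofReal (K * (1 / 8) ^ d) := by
          rw [← ENNReal.ofReal_add (by positivity) (by positivity)]
          congr 1
          push_cast
          ring
      _ ≤ _ + _ := by
          refine add_le_add ih (le_trans ?_ hshell)
          refine le_trans (le_of_eq ?_) (mul_le_mul_right hvol _)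
          rw [← ENNReal.ofReal_mul (by positivity)]
          congr 1
          rw [mul_assoc, ← inv_pow, ← mul_pow, hb]
          congr 2
          rw [pow_succ]
          field_simp
      _ = _ := by
          rw [add_comm, ← lintegral_inter_add_sdiff _ (cubeSet d (2 ^ (n + 1))) (hmeas (2 ^ n)),
            Set.inter_eq_self_of_subset_right hsub, add_comm]

lemma gs_sq_le_setLIntegral_weight {d : ℕ} (hd : 1 ≤ d) {s : ℝ} (hs : s < 0) :
    ∃ c : ℝ, 0 < c ∧ ∀ A : ℝ, 1 ≤ A → ENNReal.ofReal (c * gs d s A ^ 2) ≤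
      ∫⁻ ξ in cubeSet d A, ENNReal.ofReal ((1 + ‖ξ‖ ^ 2) ^ s) := by
  have hlow : ∀ B : ℝ, 1 ≤ B →
      ENNReal.ofReal (((1 + (d : ℝ) ^ 2) * B ^ 2) ^ s * (B / 4) ^ d) ≤
        ∫⁻ ξ in cubeSet d B, ENNReal.ofReal ((1 + ‖ξ‖ ^ 2) ^ s) := by
    intro B hB
    have h := ofReal_weight_mul_volume_le (d := d) hs.le hB
      (measurableSet_coordBox d 0 (B / 8)) (coordBox_zero_mono d (by linarith))
    rw [volume_coordBox d 0 (by linarith), ← ENNReal.ofReal_mul (by positivity)] at h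
    rw [cubeSet_eq_coordBox]
    convert h using 4
    ring
  have hmono : ∀ {B A : ℝ}, B ≤ A →
      ∫⁻ ξ in cubeSet d B, ENNReal.ofReal ((1 + ‖ξ‖ ^ 2) ^ s) ≤
        ∫⁻ ξ in cubeSet d A, ENNReal.ofReal ((1 + ‖ξ‖ ^ 2) ^ s) := by
    intro B A hBA
    refine lintegral_mono_set ?_
    rw [cubeSet_eq_coordBox, cubeSet_eq_coordBox]
    exact coordBox_zero_mono d (by linarith)
  rcases lt_trichotomy s (-(d : ℝ) / 2) with h | h | h
  · refine ⟨(1 + (d : ℝ) ^ 2) ^ s * (1 / 4) ^ d, by positivity, fun A hA => ?_⟩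
    rw [gs, if_pos h]
    simpa using (hlow 1 le_rfl).trans (hmono hA)
  · obtain ⟨c, hc, hdy⟩ := weight_critical_dyadic hd
    rw [← h] at hdy
    refine ⟨c / 2, by positivity, fun A hA => ?_⟩
    rw [gs, if_neg h.not_lt, if_pos h]
    obtain ⟨n, hn, hn'⟩ := exists_nat_pow_near hA one_lt_two
    have hs1 : 1 ≤ Real.sqrt (1 + A ^ 2) := Real.one_le_sqrt.mpr (by nlinarith)
    have hs2 : Real.sqrt (1 + A ^ 2) ≤ 2 ^ (n + 2) := by
      refine Real.sqrt_le_iff.mpr ⟨by positivity, ?_⟩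
      have h1 : (2 : ℝ) ^ (n + 2) = 2 * 2 ^ (n + 1) := by ring
      rw [h1]
      nlinarith
    have hlog : Real.log (Real.sqrt (1 + A ^ 2)) ≤ 2 * (n + 1) := by
      refine (Real.log_le_log (by linarith) hs2).trans ?_
      rw [Real.log_pow]
      push_cast
      have := Real.log_two_lt_d9
      nlinarith [show (0 : ℝ) ≤ n by positivity]
    rw [Real.sq_sqrt (Real.log_nonneg hs1)]
    have h' := (hdy n).trans (hmono hn)
    refine le_trans (ENNReal.ofReal_le_ofReal ?_) h'
    nlinarith
  · refine ⟨(1 + (d : ℝ) ^ 2) ^ s * (1 / 4) ^ d, by positivity, fun A hA => ?_⟩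
    have hA0 : 0 < A := by linarith
    rw [gs, if_neg (not_lt.mpr h.le), if_neg h.ne']
    refine le_trans (le_of_eq ?_) (hlow A hA)
    congr 1
    rw [Real.mul_rpow (by positivity) (by positivity), div_pow A, ← Real.rpow_natCast A 2,
      ← Real.rpow_mul hA0.le, ← Real.rpow_natCast A d, ← Real.rpow_natCast (A ^ _) 2,
      ← Real.rpow_mul hA0.le]
    have : ((d : ℝ) / 2 + s) * ((2 : ℕ) : ℝ) = ((2 : ℕ) : ℝ) * s + d := by push_cast; ring
    rw [this, Real.rpow_add hA0, one_div, inv_pow]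
    ring

/-- The real-valued `(n+1)`-fold convolution `h ∗ ⋯ ∗ h`. -/
def realConvIter (d : ℕ) (h : Edim d → ℝ) : ℕ → Edim d → ℝ
  | 0 => h
  | n + 1 => fun ξ => ∫ η, realConvIter d h n (ξ - η) * h η

lemma convIter_ofReal (d : ℕ) (h : Edim d → ℝ) (n : ℕ) :
    convIter d (fun ξ => (h ξ : ℂ)) n = fun ξ => (realConvIter d h n ξ : ℂ) := by
  induction n with
  | zero => rfl
  | succ n ih =>
    funext ξ
    simp only [convIter, conv, realConvIter, ih]
    rw [← integral_complex_ofReal]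
    simp

lemma foldl_conv_replicate (d : ℕ) (f : Edim d → ℂ) (m n : ℕ) :
    (List.replicate n f).foldl (conv d) (convIter d f m) = convIter d f (m + n) := by
  induction n generalizing m with
  | zero => rfl
  | succ n ih =>
    rw [List.replicate_succ, List.foldl_cons, show m + (n + 1) = (m + 1) + n by ring, ← ih (m + 1)]
    rfl

lemma listConv_ofFn_const (d n : ℕ) (f : Edim d → ℂ) :
    listConv d (List.ofFn fun _ : Fin (n + 1) => f) = convIter d f n := by
  rw [List.ofFn_const, List.replicate_succ]
  exact (foldl_conv_replicate d f 0 n).trans (by rw [zero_add])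

lemma measurable_realConvIter {d : ℕ} {h : ℝ → Edim d → ℝ}
    (hh : Measurable (Function.uncurry h)) (n : ℕ) :
    Measurable (Function.uncurry fun t => realConvIter d (h t) n) := by
  induction n with
  | zero => exact hh
  | succ n ih =>
    have hm : StronglyMeasurable (Function.uncurry fun (p : ℝ × Edim d) (η : Edim d) =>
        realConvIter d (h p.1) n (p.2 - η) * h p.1 η) := by
      refine Measurable.stronglyMeasurable (Measurable.mul ?_ ?_)
      · exact ih.comp (f := fun q : (ℝ × Edim d) × Edim d => (q.1.1, q.1.2 - q.2)) (by fun_prop)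
      · exact hh.comp (f := fun q : (ℝ × Edim d) × Edim d => (q.1.1, q.2)) (by fun_prop)
    exact hm.integral_prod_right.measurable

/-- The convolution powers of a nonnegative integrable function are nonnegative and bounded in
terms of a pointwise bound and a bound for its integral. -/
lemma realConvIter_nonneg_le {d : ℕ} {h : Edim d → ℝ} {M I : ℝ}
    (hint : Integrable h) (h0 : ∀ ξ, 0 ≤ h ξ) (hM : ∀ ξ, h ξ ≤ M) (hI : ∫ ξ, h ξ ≤ I) (n : ℕ) :
    ∀ ξ, 0 ≤ realConvIter d h n ξ ∧ realConvIter d h n ξ ≤ M * I ^ n := by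
  have hM0 : 0 ≤ M := (h0 0).trans (hM 0)
  have hI0 : 0 ≤ I := (integral_nonneg h0).trans hI
  induction n with
  | zero => exact fun ξ => ⟨h0 ξ, by simpa [realConvIter] using hM ξ⟩
  | succ n ih =>
    intro ξ
    refine ⟨integral_nonneg fun η => mul_nonneg (ih _).1 (h0 _), ?_⟩
    calc realConvIter d h (n + 1) ξ ≤ ∫ η, M * I ^ n * h η := by
          refine integral_mono_of_nonneg
            (Eventually.of_forall fun η => mul_nonneg (ih _).1 (h0 _)) (hint.const_mul _)
            (Eventually.of_forall fun η => mul_le_mul_of_nonneg_right (ih _).2 (h0 _))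
      _ ≤ M * I ^ (n + 1) := by
          rw [integral_const_mul, pow_succ, ← mul_assoc]
          gcongr

lemma integrable_realConvIter_mul {d : ℕ} {h : Edim d → ℝ} {M : ℝ} (hmeas : Measurable h)
    (hint : Integrable h) (h0 : ∀ ξ, 0 ≤ h ξ) (hM : ∀ ξ, h ξ ≤ M) (n : ℕ) (ξ : Edim d) :
    Integrable fun η => realConvIter d h n (ξ - η) * h η := by
  have hb := realConvIter_nonneg_le hint h0 hM le_rfl n
  have hm : Measurable (realConvIter d h n) :=
    (measurable_realConvIter (h := fun _ => h) (hmeas.comp measurable_snd) n).comp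
      (measurable_prodMk_left (x := (0 : ℝ)))
  refine hint.bdd_mul (c := M * (∫ ξ, h ξ) ^ n)
    (hm.comp (by fun_prop)).aestronglyMeasurable (Eventually.of_forall fun η => ?_)
  rw [Real.norm_eq_abs, abs_of_nonneg (hb _).1]
  exact (hb _).2

/-- The convolution of functions bounded below on cubes is bounded below on the cube of the same
size around the sum of the centres. -/
lemma le_convolution_of_le_on_coordBox {d : ℕ} {f g : Edim d → ℝ} {a b ξ : Edim d} {K L r : ℝ}
    (hr : 0 ≤ r) (hL : 0 ≤ L) (hf0 : ∀ ξ, 0 ≤ f ξ) (hg0 : ∀ ξ, 0 ≤ g ξ)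
    (hf : ∀ ξ ∈ coordBox d a r, K ≤ f ξ) (hg : ∀ ξ ∈ coordBox d b r, L ≤ g ξ)
    (hint : Integrable fun η => f (ξ - η) * g η) (hξ : ξ ∈ coordBox d (a + b) r) :
    K * L * r ^ d ≤ ∫ η, f (ξ - η) * g η := by
  set S : Set (Edim d) := coordBox d ((1 / 2 : ℝ) • (ξ - a + b)) (r / 2) with hS
  have hvol : volume.real S = r ^ d := by
    rw [measureReal_def, hS, volume_coordBox _ _ (by positivity),
      ENNReal.toReal_ofReal (by positivity)]
    congr 1
    ring
  have hfin : volume S ≠ ⊤ := by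
    rw [hS, volume_coordBox _ _ (by positivity)]
    exact ENNReal.ofReal_ne_top
  calc K * L * r ^ d = ∫ _η in S, K * L := by
        rw [setIntegral_const, hvol, smul_eq_mul, mul_comm]
    _ ≤ ∫ η in S, f (ξ - η) * g η := by
        refine setIntegral_mono_on (integrableOn_const hfin) hint.integrableOn
          (measurableSet_coordBox _ _ _) fun η hη => ?_
        refine mul_le_mul (hf _ fun i => ?_) (hg _ fun i => ?_) hL (hf0 _)
        all_goals
          have h1 := abs_le.mp (hη i)
          have h2 := abs_le.mp (hξ i)
          simp only [PiLp.smul_apply, PiLp.add_apply, PiLp.sub_apply, smul_eq_mul] at h1 h2 ⊢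
          exact abs_le.mpr ⟨by linarith, by linarith⟩
    _ ≤ ∫ η, f (ξ - η) * g η :=
        setIntegral_le_integral hint (Eventually.of_forall fun η => mul_nonneg (hf0 _) (hg0 _))

/-- The point `c e₁` of frequency space. -/
def axisPt (d : ℕ) (c : ℝ) : Edim d := WithLp.toLp 2 fun i => if (i : ℕ) = 0 then c else 0

lemma axisPt_add (d : ℕ) (a b : ℝ) : axisPt d a + axisPt d b = axisPt d (a + b) := by
  ext i
  simp only [axisPt, PiLp.add_apply]
  split_ifs <;> simp

lemma axisPt_zero (d : ℕ) : axisPt d 0 = 0 := by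
  ext i
  simp [axisPt]

lemma mem_OmegaSet_iff {d : ℕ} {N A : ℝ} {ξ : Edim d} :
    ξ ∈ OmegaSet d N A ↔
      ∃ c : ℝ, (c = -2 * N ∨ c = -N ∨ c = N ∨ c = 2 * N) ∧ ξ ∈ coordBox d (axisPt d c) (A / 8) :=
  Iff.rfl

lemma measurableSet_OmegaSet (d : ℕ) (N A : ℝ) : MeasurableSet (OmegaSet d N A) := by
  have : OmegaSet d N A = coordBox d (axisPt d (-2 * N)) (A / 8) ∪
      coordBox d (axisPt d (-N)) (A / 8) ∪ coordBox d (axisPt d N) (A / 8) ∪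
      coordBox d (axisPt d (2 * N)) (A / 8) := by
    ext ξ
    rw [mem_OmegaSet_iff]
    simp only [Set.mem_union]
    aesop
  rw [this]
  exact (((measurableSet_coordBox _ _ _).union (measurableSet_coordBox _ _ _)).union
    (measurableSet_coordBox _ _ _)).union (measurableSet_coordBox _ _ _)

lemma OmegaSet_subset_coordBox (d : ℕ) {N A : ℝ} (hA : 0 ≤ A) (hAN : A ≤ N) :
    OmegaSet d N A ⊆ coordBox d 0 (3 * N) := by
  rintro ξ ⟨c, hc, hξ⟩ i
  have hci : |if (i : ℕ) = 0 then c else 0| ≤ 2 * N := by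
    split_ifs
    · rw [abs_le]
      rcases hc with rfl | rfl | rfl | rfl <;> constructor <;> linarith
    · simp only [abs_zero]
      linarith
  have h1 := abs_le.mp (hξ i)
  have h2 := abs_le.mp hci
  simp only [PiLp.zero_apply, sub_zero]
  exact abs_le.mpr ⟨by linarith, by linarith⟩

lemma volume_OmegaSet_lt_top (d : ℕ) {N A : ℝ} (hA : 0 ≤ A) (hAN : A ≤ N) :
    volume (OmegaSet d N A) < ⊤ := by
  refine (measure_mono (OmegaSet_subset_coordBox d hA hAN)).trans_lt ?_
  rw [volume_coordBox d 0 (by linarith)]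
  exact ENNReal.ofReal_lt_top

section ConvolutionPowers

variable {d : ℕ} {h : Edim d → ℝ} {M K N A : ℝ} (hmeas : Measurable h) (hint : Integrable h)
  (h0 : ∀ ξ, 0 ≤ h ξ) (hM : ∀ ξ, h ξ ≤ M) (hA : 0 ≤ A) (hK : 0 ≤ K)
  (hlow : ∀ ξ ∈ OmegaSet d N A, K ≤ h ξ)

include hmeas hint h0 hM hA hK hlow

lemma le_realConvIter_of_add {n : ℕ} {L a b : ℝ}
    (hn : ∀ ξ ∈ coordBox d (axisPt d a) (A / 8), L ≤ realConvIter d h n ξ)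
    (hb : b = -2 * N ∨ b = -N ∨ b = N ∨ b = 2 * N) {ξ : Edim d}
    (hξ : ξ ∈ coordBox d (axisPt d (a + b)) (A / 8)) :
    L * K * (A / 8) ^ d ≤ realConvIter d h (n + 1) ξ :=
  le_convolution_of_le_on_coordBox (by positivity) hK
    (fun ξ => (realConvIter_nonneg_le hint h0 hM le_rfl n ξ).1) h0 hn
    (fun ξ hξ => hlow ξ (mem_OmegaSet_iff.mpr ⟨b, hb, hξ⟩))
    (integrable_realConvIter_mul hmeas hint h0 hM n ξ)
    (by rwa [axisPt_add])

lemma le_realConvIter_on_OmegaSet (n : ℕ) :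
    ∀ ξ ∈ OmegaSet d N A, K ^ (n + 1) * (A / 8) ^ (d * n) ≤ realConvIter d h n ξ := by
  induction n with
  | zero => simpa [realConvIter] using hlow
  | succ n ih =>
    rintro ξ ⟨c, hc, hξ⟩
    have key : ∃ a b : ℝ, (a = -2 * N ∨ a = -N ∨ a = N ∨ a = 2 * N) ∧
        (b = -2 * N ∨ b = -N ∨ b = N ∨ b = 2 * N) ∧ a + b = c := by
      rcases hc with hc | hc | hc | hc
      · exact ⟨-N, -N, by simp, by simp, by rw [hc]; ring⟩
      · exact ⟨-2 * N, N, by simp, by simp, by rw [hc]; ring⟩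
      · exact ⟨2 * N, -N, by simp, by simp, by rw [hc]; ring⟩
      · exact ⟨N, N, by simp, by simp, by rw [hc]; ring⟩
    obtain ⟨a, b, ha, hb, rfl⟩ := key
    have hstep := le_realConvIter_of_add hmeas hint h0 hM hA hK hlow
      (L := K ^ (n + 1) * (A / 8) ^ (d * n))
      (fun ξ hξ => ih ξ ⟨a, ha, hξ⟩) hb hξ
    refine le_trans (le_of_eq ?_) hstep
    rw [mul_add, pow_add]
    ring

lemma le_realConvIter_on_cubeSet (n : ℕ) :
    ∀ ξ ∈ cubeSet d A, K ^ (n + 2) * (A / 8) ^ (d * (n + 1)) ≤ realConvIter d h (n + 1) ξ := by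
  intro ξ hξ
  have hstep := le_realConvIter_of_add hmeas hint h0 hM hA hK hlow
    (L := K ^ (n + 1) * (A / 8) ^ (d * n)) (a := N) (b := -N) (ξ := ξ)
    (fun ξ hξ => le_realConvIter_on_OmegaSet hmeas hint h0 hM hA hK hlow n ξ ⟨N, by simp, hξ⟩)
    (by simp) (by rwa [add_neg_cancel, axisPt_zero, ← cubeSet_eq_coordBox])
  refine le_trans (le_of_eq ?_) hstep
  rw [mul_add, pow_add]
  ring

end ConvolutionPowers

lemma half_le_Psym_mul_V0sym {t r : ℝ} (h0 : 0 ≤ r * t) (h1 : r * t ≤ 1 / 2) :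
    1 / 2 ≤ Psym t r * V0sym t r := by
  have hP : 3 / 4 ≤ Psym t r := by
    have := Real.add_one_le_exp (-(r * t) / 2)
    rw [Psym]
    linarith
  have h3 : Real.sqrt 3 ^ 2 = 3 := Real.sq_sqrt (by norm_num)
  have h32 : Real.sqrt 3 ≤ 2 := by nlinarith [Real.sqrt_nonneg 3]
  set y : ℝ := Real.sqrt 3 / 2 * r * t with hy
  have hy2 : y ^ 2 = 3 / 4 * (r * t) ^ 2 := by
    rw [hy, show Real.sqrt 3 / 2 * r * t = Real.sqrt 3 * (r * t / 2) by ring, mul_pow, h3]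
    ring
  have hy0 : 0 ≤ y := by rw [hy, mul_assoc]; positivity
  have hy1 : y ≤ 1 := by
    rw [hy, mul_assoc]
    nlinarith
  have hV : 3 / 4 ≤ V0sym t r := by
    have hc := Real.one_sub_sq_div_two_le_cos (x := y)
    have hsin : 0 ≤ 1 / Real.sqrt 3 * Real.sin y :=
      mul_nonneg (by positivity)
        (Real.sin_nonneg_of_nonneg_of_le_pi hy0 (hy1.trans (by linarith [Real.pi_gt_three])))
    rw [V0sym, ← hy]
    nlinarith
  nlinarith

lemma Psym_mul_V0sym_le_two {t r : ℝ} (h0 : 0 ≤ r * t) : Psym t r * V0sym t r ≤ 2 := by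
  have hP : Psym t r ≤ 1 := by
    rw [Psym]
    exact Real.exp_le_one_iff.mpr (by linarith)
  have hP0 : 0 < Psym t r := Real.exp_pos _
  have h3 : 1 / Real.sqrt 3 ≤ 1 := by
    rw [div_le_one (by positivity)]
    exact Real.one_le_sqrt.mpr (by norm_num)
  have hV : V0sym t r ≤ 2 := by
    rw [V0sym]
    have h4 : 0 ≤ 1 / Real.sqrt 3 := by positivity
    nlinarith [Real.cos_le_one (Real.sqrt 3 / 2 * r * t), Real.sin_le_one (Real.sqrt 3 / 2 * r * t)]
  nlinarith

lemma le_Wsym {t r : ℝ} (hr : 0 < r) (ht : 0 ≤ t) (h1 : r * t ≤ 1 / 2) : t / 4 ≤ Wsym t r := by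
  have h0 : 0 ≤ r * t := by positivity
  have hP : 1 / 2 ≤ Psym t r := by
    have := Real.add_one_le_exp (-(r * t) / 2)
    rw [Psym]
    linarith
  have h3 : Real.sqrt 3 ≤ 2 := by
    nlinarith [Real.sqrt_nonneg 3, Real.sq_sqrt (show (0 : ℝ) ≤ 3 by norm_num)]
  have hy0 : 0 ≤ Real.sqrt 3 / 2 * r * t := by positivity
  have hy1 : Real.sqrt 3 / 2 * r * t ≤ 1 := by
    rw [mul_assoc]
    nlinarith
  have hV : t / 2 ≤ V1sym t r := by
    rw [V1sym, le_div_iff₀ (by positivity)]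
    refine le_trans ?_ (Real.mul_le_sin hy0 (hy1.trans (by linarith [Real.pi_gt_three])))
    have hpi : 1 / 2 ≤ 2 / π := by
      rw [div_le_div_iff₀ two_pos Real.pi_pos]
      linarith [Real.pi_le_four]
    nlinarith
  rw [Wsym]
  nlinarith

lemma Xi_one_eq (d n : ℕ) (F₀ F₁ : Edim d → ℂ) (t : ℝ) (ξ : Edim d) :
    Xi d (n + 1) F₀ F₁ 1 t ξ =
      -∫ t' in (0 : ℝ)..t, ((Wsym (t - t') ‖ξ‖ : ℝ) : ℂ) * convIter d (Vflow d F₀ F₁ t') n ξ := by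
  have h0 : Xi d (n + 1) F₀ F₁ 0 = Vflow d F₀ F₁ := by rw [Xi]
  rw [Xi]
  beta_reduce
  rw [Finset.sum_attach (Finset.Nat.antidiagonalTuple (n + 1) 0)
    (fun l => Ik d (n + 1) (fun i => Xi d (n + 1) F₀ F₁ (l i)) t ξ),
    Finset.Nat.antidiagonalTuple_zero_right, Finset.sum_singleton]
  simp only [Pi.zero_apply, h0, Ik, listConv_ofFn_const]

/-- The linear evolution of `φ⃗ = (φ, 0)` on the Fourier side, as a real function. -/
def flowPhi (d : ℕ) (N A R t : ℝ) (ξ : Edim d) : ℝ :=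
  Psym t ‖ξ‖ * V0sym t ‖ξ‖ * (OmegaSet d N A).indicator (fun _ => R) ξ

lemma Vflow_phiHat (d : ℕ) (N A R t : ℝ) :
    Vflow d (phiHat d N A R) (fun _ => 0) t = fun ξ => (flowPhi d N A R t ξ : ℂ) := by
  funext ξ
  by_cases h : ξ ∈ OmegaSet d N A <;> simp [Vflow, flowPhi, phiHat, h]

lemma measurable_flowPhi (d : ℕ) (N A R : ℝ) : Measurable (Function.uncurry (flowPhi d N A R)) := by
  have hcont : Continuous fun p : ℝ × Edim d => Psym p.1 ‖p.2‖ * V0sym p.1 ‖p.2‖ := by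
    unfold Psym V0sym
    fun_prop
  exact hcont.measurable.mul
    ((measurable_const.indicator (measurableSet_OmegaSet d N A)).comp measurable_snd)

lemma norm_Xi_one (d n : ℕ) (N A R t : ℝ) (ξ : Edim d) :
    ‖Xi d (n + 1) (phiHat d N A R) (fun _ => 0) 1 t ξ‖ =
      |∫ t' in (0 : ℝ)..t, Wsym (t - t') ‖ξ‖ * realConvIter d (flowPhi d N A R t') n ξ| := by
  rw [Xi_one_eq, norm_neg, ← Real.norm_eq_abs, ← Complex.norm_real,
    ← intervalIntegral.integral_ofReal]
  simp only [Vflow_phiHat, convIter_ofReal, Complex.ofReal_mul]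

section ShortTime

variable {d : ℕ} {N A R t : ℝ} (hA : 0 ≤ A) (hAN : A ≤ N) (hR : 0 < R)
  (hNt : d * (3 * N) * t ≤ 1 / 2)

include hA hAN hR hNt

lemma flowPhi_bounds {t' : ℝ} (ht' : t' ∈ Set.Icc 0 t) (ξ : Edim d) :
    0 ≤ flowPhi d N A R t' ξ ∧
      flowPhi d N A R t' ξ ≤ (OmegaSet d N A).indicator (fun _ => 2 * R) ξ ∧
      (ξ ∈ OmegaSet d N A → R / 2 ≤ flowPhi d N A R t' ξ) := by
  by_cases h : ξ ∈ OmegaSet d N A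
  · have hn : ‖ξ‖ ≤ d * (3 * N) := norm_le_of_abs_coord_le (by linarith) fun i => by
      simpa using OmegaSet_subset_coordBox d hA hAN h i
    have h0 : 0 ≤ ‖ξ‖ * t' := mul_nonneg (norm_nonneg _) ht'.1
    have h1 : ‖ξ‖ * t' ≤ 1 / 2 :=
      (mul_le_mul hn ht'.2 ht'.1 ((norm_nonneg _).trans hn)).trans hNt
    have hl := half_le_Psym_mul_V0sym h0 h1
    have hu := Psym_mul_V0sym_le_two h0
    simp only [flowPhi, Set.indicator_of_mem h]
    exact ⟨by nlinarith, by nlinarith, fun _ => by nlinarith⟩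
  · simp [flowPhi, h]

lemma integrable_flowPhi {t' : ℝ} (ht' : t' ∈ Set.Icc 0 t) : Integrable (flowPhi d N A R t') := by
  have hind : Integrable ((OmegaSet d N A).indicator fun _ => 2 * R) :=
    (integrableOn_const (volume_OmegaSet_lt_top d hA hAN).ne).integrable_indicator
      (measurableSet_OmegaSet d N A)
  have hm : Measurable (flowPhi d N A R t') :=
    (measurable_flowPhi d N A R).of_uncurry_left
  refine hind.mono' hm.aestronglyMeasurable (Eventually.of_forall fun ξ => ?_)
  have hb := flowPhi_bounds hA hAN hR hNt ht' ξ
  rw [Real.norm_eq_abs, abs_of_nonneg hb.1]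
  exact hb.2.1

lemma integral_flowPhi_le {t' : ℝ} (ht' : t' ∈ Set.Icc 0 t) :
    ∫ ξ, flowPhi d N A R t' ξ ≤ volume.real (OmegaSet d N A) * (2 * R) := by
  have hind : Integrable ((OmegaSet d N A).indicator fun _ => 2 * R) :=
    (integrableOn_const (volume_OmegaSet_lt_top d hA hAN).ne).integrable_indicator
      (measurableSet_OmegaSet d N A)
  refine (integral_mono (integrable_flowPhi hA hAN hR hNt ht') hind
    fun ξ => (flowPhi_bounds hA hAN hR hNt ht' ξ).2.1).trans (le_of_eq ?_)
  rw [integral_indicator (measurableSet_OmegaSet d N A), setIntegral_const, smul_eq_mul]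

lemma le_norm_Xi_one (ht : 0 ≤ t) (n : ℕ) {ξ : Edim d} (hξ : ξ ∈ cubeSet d A) (hξ0 : ξ ≠ 0) :
    (R / 2) ^ (n + 2) * (A / 8) ^ (d * (n + 1)) * t ^ 2 / 8 ≤
      ‖Xi d (n + 2) (phiHat d N A R) (fun _ => 0) 1 t ξ‖ := by
  set L : ℝ := (R / 2) ^ (n + 2) * (A / 8) ^ (d * (n + 1)) with hL
  have hle_two : ∀ t' ∈ Set.Icc 0 t, ∀ ξ, flowPhi d N A R t' ξ ≤ 2 * R := fun t' ht' ξ =>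
    (flowPhi_bounds hA hAN hR hNt ht' ξ).2.1.trans
      (Set.indicator_le_self' (fun _ _ => by positivity) ξ)
  have hbound : ∀ t' ∈ Set.Icc 0 t,
      0 ≤ realConvIter d (flowPhi d N A R t') (n + 1) ξ ∧
        realConvIter d (flowPhi d N A R t') (n + 1) ξ ≤
          2 * R * (volume.real (OmegaSet d N A) * (2 * R)) ^ (n + 1) := fun t' ht' =>
    realConvIter_nonneg_le (integrable_flowPhi hA hAN hR hNt ht')
      (fun ξ => (flowPhi_bounds hA hAN hR hNt ht' ξ).1) (hle_two t' ht')
      (integral_flowPhi_le hA hAN hR hNt ht') (n + 1) ξ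
  have hlow : ∀ t' ∈ Set.Icc 0 t, L ≤ realConvIter d (flowPhi d N A R t') (n + 1) ξ :=
    fun t' ht' => le_realConvIter_on_cubeSet
      (measurable_flowPhi d N A R).of_uncurry_left
      (integrable_flowPhi hA hAN hR hNt ht')
      (fun ξ => (flowPhi_bounds hA hAN hR hNt ht' ξ).1) (hle_two t' ht') hA (by positivity)
      (fun ξ => (flowPhi_bounds hA hAN hR hNt ht' ξ).2.2) n ξ hξ
  have hconv : IntervalIntegrable
      (fun t' => realConvIter d (flowPhi d N A R t') (n + 1) ξ) volume 0 t := by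
    rw [intervalIntegrable_iff_integrableOn_Ioc_of_le ht]
    refine Measure.integrableOn_of_bounded
      (M := 2 * R * (volume.real (OmegaSet d N A) * (2 * R)) ^ (n + 1)) (by simp) ?_ ?_
    · exact ((measurable_realConvIter (measurable_flowPhi d N A R) (n + 1)).comp
        (measurable_prodMk_right (y := ξ))).aestronglyMeasurable
    · refine (ae_restrict_iff' measurableSet_Ioc).mpr (Eventually.of_forall fun t' ht' => ?_)
      have hb := hbound t' (Set.Ioc_subset_Icc_self ht')
      rw [Real.norm_eq_abs, abs_of_nonneg hb.1]
      exact hb.2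
  have hW : Continuous fun t' => Wsym (t - t') ‖ξ‖ :=
    (continuous_Wsym ‖ξ‖).comp (continuous_const.sub continuous_id)
  have hn : ‖ξ‖ ≤ d * (3 * N) := norm_le_of_abs_coord_le (by linarith) fun i =>
    (hξ i).trans (by linarith)
  rw [norm_Xi_one]
  refine le_trans ?_ (le_abs_self _)
  have hbase : ∫ t' in (0 : ℝ)..t, (t - t') / 4 * L = L * t ^ 2 / 8 := by
    rw [intervalIntegral.integral_mul_const, intervalIntegral.integral_div,
      intervalIntegral.integral_sub (by simp) (by simp)]
    simp
    ring
  rw [← hbase]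
  refine intervalIntegral.integral_mono_on ht (Continuous.intervalIntegrable (by fun_prop) _ _)
    (hconv.continuousOn_mul hW.continuousOn) fun t' ht' => ?_
  refine mul_le_mul (le_Wsym (norm_pos_iff.mpr hξ0) (by linarith [ht'.2]) ?_) (hlow t' ht')
    (by positivity) ?_
  · refine le_trans ?_ hNt
    exact mul_le_mul hn (by linarith [ht'.1]) (by linarith [ht'.2]) ((norm_nonneg _).trans hn)
  · refine le_trans (by linarith [ht'.2]) (le_Wsym (t := t - t') (norm_pos_iff.mpr hξ0)
      (by linarith [ht'.2]) ?_)
    refine le_trans ?_ hNt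
    exact mul_le_mul hn (by linarith [ht'.1]) (by linarith [ht'.2]) ((norm_nonneg _).trans hn)

end ShortTime

lemma le_HsNorm_of_le_on_cubeSet {d : ℕ} (hd : 1 ≤ d) {s A X w : ℝ} {F : Edim d → ℂ}
    (hX : 0 ≤ X) (hw : 0 ≤ w) (hF : ∀ ξ ∈ cubeSet d A, ξ ≠ 0 → X ≤ ‖F ξ‖)
    (hweight : ENNReal.ofReal (w ^ 2) ≤
      ∫⁻ ξ in cubeSet d A, ENNReal.ofReal ((1 + ‖ξ‖ ^ 2) ^ s)) :
    ENNReal.ofReal (X * w) ≤ HsNorm d s F := by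
  have : Nonempty (Fin d) := ⟨⟨0, hd⟩⟩
  have hmeas : MeasurableSet (cubeSet d A) := by
    rw [cubeSet_eq_coordBox]
    exact measurableSet_coordBox _ _ _
  have hsq : ENNReal.ofReal ((X * w) ^ 2) ≤ HsNormSq d s F := by
    calc ENNReal.ofReal ((X * w) ^ 2)
        = ENNReal.ofReal (w ^ 2) * ENNReal.ofReal (X ^ 2) := by
          rw [← ENNReal.ofReal_mul (by positivity), mul_pow, mul_comm]
      _ ≤ (∫⁻ ξ in cubeSet d A, ENNReal.ofReal ((1 + ‖ξ‖ ^ 2) ^ s)) * ENNReal.ofReal (X ^ 2) := by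
          gcongr
      _ = ∫⁻ ξ in cubeSet d A, ENNReal.ofReal ((1 + ‖ξ‖ ^ 2) ^ s) * ENNReal.ofReal (X ^ 2) :=
          (lintegral_mul_const' _ _ ENNReal.ofReal_ne_top).symm
      _ ≤ ∫⁻ ξ in cubeSet d A, ENNReal.ofReal ((1 + ‖ξ‖ ^ 2) ^ s * ‖F ξ‖ ^ 2) := by
          refine lintegral_mono_ae ((ae_restrict_iff' hmeas).mpr ?_)
          filter_upwards [Measure.ae_ne volume (0 : Edim d)] with ξ hξ0 hξ
          rw [← ENNReal.ofReal_mul (by positivity)]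
          refine ENNReal.ofReal_le_ofReal ?_
          have := hF ξ hξ hξ0
          gcongr
      _ ≤ HsNormSq d s F := setLIntegral_le_lintegral _ _
  calc ENNReal.ofReal (X * w) = ENNReal.ofReal ((X * w) ^ 2) ^ (1 / 2 : ℝ) := by
        rw [ENNReal.ofReal_rpow_of_nonneg (by positivity) (by norm_num), ← Real.sqrt_eq_rpow,
          Real.sqrt_sq (by positivity)]
    _ ≤ HsNorm d s F := ENNReal.rpow_le_rpow hsq (by norm_num)

lemma gs_nonneg (d : ℕ) (s : ℝ) {A : ℝ} (hA : 0 ≤ A) : 0 ≤ gs d s A := by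
  unfold gs
  split_ifs <;> positivity

/-- Proposition 3.4: lower bound
`‖Ξ₁(φ⃗)(t)‖_{H^s} ≳ R^k t² A^{d(k-1)} g_s(A)` for `1 ≤ A ≪ N` and `0 < t ≪ N⁻¹`,
where `φ̂ = R·𝟙_Ω` and `φ⃗ = (φ,0)`. -/
theorem Xi1_lower_bound_short_time
    (d k : ℕ) (hd : 1 ≤ d) (hk : 2 ≤ k) (s : ℝ) (hs : s < 0) :
    ∃ c δ : ℝ, 0 < c ∧ 0 < δ ∧
      ∀ A N R t : ℝ, 1 ≤ A → A / δ ≤ N → 0 < R → 0 < t → t ≤ δ / N →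
        ENNReal.ofReal (c * R ^ k * t ^ 2 * A ^ (d * (k - 1)) * gs d s A) ≤
          HsNorm d s (Xi d k (phiHat d N A R) (fun _ => 0) 1 t) := by
  obtain ⟨c, hc, hweight⟩ := gs_sq_le_setLIntegral_weight hd hs
  obtain ⟨n, rfl⟩ : ∃ n, k = n + 2 := ⟨k - 2, by omega⟩
  have hd' : (1 : ℝ) ≤ d := by exact_mod_cast hd
  refine ⟨(1 / 2) ^ (n + 2) * (1 / 8) ^ (d * (n + 1)) / 8 * Real.sqrt c, 1 / (6 * d),
    by positivity, by positivity, fun A N R t hA hN hR ht htN => ?_⟩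
  have hA0 : 0 < A := by linarith
  have hAN : A ≤ N := by
    refine le_trans ?_ hN
    rw [div_div_eq_mul_div, div_one]
    nlinarith
  have hN0 : 0 < N := by linarith
  have hNt : d * (3 * N) * t ≤ 1 / 2 := by
    rw [div_div, le_div_iff₀ (by positivity)] at htN
    linarith
  have hg := gs_nonneg d s hA0.le
  refine le_trans (le_of_eq ?_) (le_HsNorm_of_le_on_cubeSet hd (A := A)
    (X := (R / 2) ^ (n + 2) * (A / 8) ^ (d * (n + 1)) * t ^ 2 / 8) (w := Real.sqrt c * gs d s A)
    (by positivity) (by positivity)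
    (fun ξ hξ hξ0 => le_norm_Xi_one hA0.le hAN hR hNt ht.le n hξ hξ0) ?_)
  · congr 1
    rw [show n + 2 - 1 = n + 1 from rfl, div_eq_mul_one_div R, div_eq_mul_one_div A, mul_pow R,
      mul_pow A]
    ring
  · rw [mul_pow, Real.sq_sqrt hc.le]
    exact hweight A hA

end
end
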